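/- arXiv:1002.0582 — 7 statements merged into one kernel-verified Lean document; each statement's English description precedes it below -/
import Mathlib

section
/- Let U ⊆ ℝⁿ be open, η a symmetric invertible n×n real matrix with inverse entries η^{αβ}, and F: U → ℝ a C⁴ function satisfying the WDVV equations. For each index α define the matrix-valued function C_α: U → Mat_{n×n}(ℝ) by (C_α)^γ_β := c^γ_{αβ} = η^{γδ} ∂³F/∂u^δ∂u^α∂u^β. Then for all indices α, β and all u ∈ U: (i) C_α(u) C_β(u) = C_β(u) C_α(u), and (ii) ∂_α C_β(u) = ∂_β C_α(u). Consequently, for every z ∈ ℝ the curvature of the one-parameter family of connections D_z = d + z C vanishes identically: z(∂_α C_β − ∂_β C_α) + z²(C_α C_β − C_β C_α) = 0. -/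
/-- Partial derivative of a scalar function on `ℝⁿ` in the `i`-th coordinate direction. -/
noncomputable def pd {n : ℕ} (i : Fin n) (f : (Fin n → ℝ) → ℝ) : (Fin n → ℝ) → ℝ :=
  fun x => fderiv ℝ f x (Pi.single i 1)

lemma pd_contDiffOn {n : ℕ} {U : Set (Fin n → ℝ)} (hU : IsOpen U) {f : (Fin n → ℝ) → ℝ}
    {k m : WithTop ℕ∞} (hf : ContDiffOn ℝ m f U) (hk : k + 1 ≤ m) (i : Fin n) :
    ContDiffOn ℝ k (pd i f) U :=
  (hf.fderiv_of_isOpen hU hk).clm_apply contDiffOn_const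

lemma pd_eq_of_eqOn {n : ℕ} {U : Set (Fin n → ℝ)} (hU : IsOpen U) {f g : (Fin n → ℝ) → ℝ}
    (h : Set.EqOn f g U) (i : Fin n) : Set.EqOn (pd i f) (pd i g) U := fun u hu => by
  simp only [pd, (h.eventuallyEq_of_mem (hU.mem_nhds hu)).fderiv_eq]

lemma pd_pd_apply {n : ℕ} {f : (Fin n → ℝ) → ℝ} {u : Fin n → ℝ}
    (hf : ContDiffAt ℝ 2 f u) (i j : Fin n) :
    pd i (pd j f) u = fderiv ℝ (fderiv ℝ f) u (Pi.single i 1) (Pi.single j 1) := by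
  have hd : DifferentiableAt ℝ (fderiv ℝ f) u :=
    (hf.fderiv_right (m := 1) (by norm_num)).differentiableAt (by norm_num)
  change fderiv ℝ (fun x => fderiv ℝ f x (Pi.single j 1)) u (Pi.single i 1) = _
  rw [fderiv_clm_apply hd (differentiableAt_const _)]
  simp

/-- Mixed partial derivatives of a `C²` function on an open set commute. -/
lemma pd_comm {n : ℕ} {U : Set (Fin n → ℝ)} (hU : IsOpen U) {f : (Fin n → ℝ) → ℝ}
    (hf : ContDiffOn ℝ 2 f U) (i j : Fin n) :
    Set.EqOn (pd i (pd j f)) (pd j (pd i f)) U := fun u hu => by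
  have hfu := hf.contDiffAt (hU.mem_nhds hu)
  rw [pd_pd_apply hfu, pd_pd_apply hfu]
  exact hfu.isSymmSndFDerivAt (by simp) _ _

/-- The outer two of three partial derivatives of a `C³` function, separated by a third one,
may be exchanged. -/
lemma pd_pd_pd_swap {n : ℕ} {U : Set (Fin n → ℝ)} (hU : IsOpen U) {f : (Fin n → ℝ) → ℝ}
    (hf : ContDiffOn ℝ 3 f U) (i j k : Fin n) :
    Set.EqOn (pd i (pd j (pd k f))) (pd k (pd j (pd i f))) U := fun u hu => by
  have h2 (l : Fin n) : ContDiffOn ℝ 2 (pd l f) U := pd_contDiffOn hU hf (by norm_num) l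
  rw [pd_comm hU (h2 k) i j hu,
    pd_eq_of_eqOn hU (pd_comm hU (hf.of_le (by norm_num)) i k) j hu,
    pd_comm hU (h2 i) j k hu]

lemma pd_sum_const_mul {n : ℕ} {ι : Type*} (s : Finset ι) (a : ι → ℝ)
    {f : ι → (Fin n → ℝ) → ℝ} {u : Fin n → ℝ} (hf : ∀ l ∈ s, DifferentiableAt ℝ (f l) u)
    (i : Fin n) :
    pd i (fun x => ∑ l ∈ s, a l * f l x) u = ∑ l ∈ s, a l * pd i (f l) u := by
  simp only [pd]
  rw [fderiv_fun_sum fun l hl => (hf l hl).const_mul (a l), sum_apply]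
  refine Finset.sum_congr rfl fun l hl => ?_
  rw [fderiv_const_mul (hf l hl)]
  simp

theorem wdvv_flat_pencil (n : ℕ) (U : Set (Fin n → ℝ)) (hU : IsOpen U)
    (η : Matrix (Fin n) (Fin n) ℝ) (hsym : η.IsSymm) (hinv : IsUnit η)
    (F : (Fin n → ℝ) → ℝ) (hF : ContDiffOn ℝ 4 F U)
    (c : Fin n → Fin n → Fin n → (Fin n → ℝ) → ℝ)
    (hc : ∀ α β γ : Fin n, c α β γ = pd α (pd β (pd γ F)))
    (hWDVV : ∀ u ∈ U, ∀ α β ε ζ : Fin n,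
      ∑ γ : Fin n, ∑ δ : Fin n, c α β γ u * η⁻¹ γ δ * c δ ε ζ u =
      ∑ γ : Fin n, ∑ δ : Fin n, c α ε γ u * η⁻¹ γ δ * c δ β ζ u)
    (C : Fin n → (Fin n → ℝ) → Matrix (Fin n) (Fin n) ℝ)
    (hC : ∀ (α : Fin n) (u : Fin n → ℝ) (γ β : Fin n),
      C α u γ β = ∑ δ : Fin n, η⁻¹ γ δ * c δ α β u) :
    ∀ α β : Fin n, ∀ u ∈ U,
      (C α u * C β u = C β u * C α u) ∧
      (∀ γ δ : Fin n, pd α (fun x => C β x γ δ) u = pd β (fun x => C α x γ δ) u) ∧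
      (∀ z : ℝ,
        z • (Matrix.of fun γ δ =>
            pd α (fun x => C β x γ δ) u - pd β (fun x => C α x γ δ) u)
          + z ^ 2 • (C α u * C β u - C β u * C α u) = 0) := by
  intro α β u hu
  have hcomm : C α u * C β u = C β u * C α u := by
    have hprod (α β i j : Fin n) : (C α u * C β u) i j = ∑ d : Fin n, η⁻¹ i d *
        ∑ k : Fin n, ∑ e : Fin n, c d α k u * η⁻¹ k e * c e β j u := by
      simp only [Matrix.mul_apply, hC, Finset.sum_mul, Finset.mul_sum]
      refine (Finset.sum_congr rfl fun k _ => Finset.sum_comm).trans (Finset.sum_comm.trans ?_)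
      simp only [mul_assoc]
    ext i j
    rw [hprod, hprod]
    exact Finset.sum_congr rfl fun d _ => by rw [hWDVV u hu d α β j]
  have hflat (γ δ : Fin n) :
      pd α (fun x => C β x γ δ) u = pd β (fun x => C α x γ δ) u := by
    have hF3 : ContDiffOn ℝ 3 (pd δ F) U := pd_contDiffOn hU hF (by norm_num) δ
    have hdiff (l β : Fin n) : DifferentiableAt ℝ (pd l (pd β (pd δ F))) u :=
      ((pd_contDiffOn (k := 1) hU (pd_contDiffOn (k := 2) hU hF3 (by norm_num) β)
        (by norm_num) l).contDiffAt (hU.mem_nhds hu)).differentiableAt (by norm_num)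
    simp only [hC, hc]
    rw [pd_sum_const_mul _ _ fun l _ => hdiff l β, pd_sum_const_mul _ _ fun l _ => hdiff l α]
    exact Finset.sum_congr rfl fun l _ => by rw [pd_pd_pd_swap hU hF3 α l β hu]
  refine ⟨hcomm, hflat, fun z => ?_⟩
  ext γ δ
  simp [hcomm, hflat γ δ]
end

section
/- Let P, Q, z ∈ ℂ with Q ≠ 0, and let Δ₊, Δ₋ ∈ ℂ satisfy Δ₊ + Δ₋ = z P/Q² and Δ₊ Δ₋ = z²/Q. Then: (i) the function A₁(w) := ₂F₁(−Δ₊, −Δ₋; 1; e^w) is a solution on (−∞,0) of the Fuchsian ODE A″(w) = (e^w/(1−e^w)) ( (z²/Q) A(w) − (P z/Q²) A′(w) ); and (ii) if moreover 2 + z P/Q² is not a nonpositive integer, the function A₂(w) := (1−e^w)^{1 + z P/Q²} · ₂F₁(1+Δ₋, 1+Δ₊; 2 + z P/Q²; 1−e^w), where (1−e^w)^{c} := exp(c·log(1−e^w)) with the real logarithm (note 1−e^w > 0 for w < 0), is also a solution of the same ODE on (−∞,0). -/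
/-- The Gauss hypergeometric series `₂F₁(a,b;c;x)` over `ℂ`, defined via Pochhammer symbols. -/
noncomputable def hyp2F1 (a b c x : ℂ) : ℂ :=
  ∑' d : ℕ, ((ascPochhammer ℂ d).eval a * (ascPochhammer ℂ d).eval b /
    ((ascPochhammer ℂ d).eval c * (d.factorial : ℂ))) * x ^ d

/-- First solution of the Fuchsian ODE: `A₁(w) = ₂F₁(−Δ₊, −Δ₋; 1; e^w)`. -/
noncomputable def solA₁ (Δp Δm : ℂ) (w : ℝ) : ℂ :=
  hyp2F1 (-Δp) (-Δm) 1 ((Real.exp w : ℝ) : ℂ)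

/-- Second solution: `A₂(w) = (1−e^w)^{1+zP/Q²} ₂F₁(1+Δ₋, 1+Δ₊; 2+zP/Q²; 1−e^w)`,
with `(1−e^w)^c := exp (c log (1−e^w))` using the real logarithm. -/
noncomputable def solA₂ (P Q z Δp Δm : ℂ) (w : ℝ) : ℂ :=
  Complex.exp ((1 + z * P / Q ^ 2) * ((Real.log (1 - Real.exp w) : ℝ) : ℂ)) *
    hyp2F1 (1 + Δm) (1 + Δp) (2 + z * P / Q ^ 2) (((1 - Real.exp w : ℝ)) : ℂ)

open Filter Topology

/-- Termwise differentiation of a power series converging on the open unit disc. -/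
lemma hasSum_deriv_tsum_mul_pow {u : ℕ → ℂ}
    (hu : ∀ x : ℂ, ‖x‖ < 1 → Summable fun n => u n * x ^ n) {x : ℂ} (hx : ‖x‖ < 1) :
    DifferentiableAt ℂ (fun y => ∑' n, u n * y ^ n) x ∧
      HasSum (fun n : ℕ => (n + 1) * u (n + 1) * x ^ n)
        (deriv (fun y => ∑' n, u n * y ^ n) x) := by
  obtain ⟨r, hxr, hr⟩ := exists_between hx
  have hr0 : 0 ≤ r := (norm_nonneg x).trans hxr.le
  have hsum : Summable fun n => ‖u n * (r : ℂ) ^ n‖ :=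
    (hu r (by simpa [abs_of_nonneg hr0] using hr)).norm
  have hdiff : ∀ n, DifferentiableOn ℂ (fun y : ℂ => u n * y ^ n) (Metric.ball 0 r) :=
    fun n => by fun_prop
  have hbound : ∀ (n : ℕ) (y : ℂ), y ∈ Metric.ball (0 : ℂ) r →
      ‖u n * y ^ n‖ ≤ ‖u n * (r : ℂ) ^ n‖ := by
    intro n y hy
    have hy' : ‖y‖ ≤ r := (mem_ball_zero_iff.1 hy).le
    simp only [norm_mul, norm_pow, Complex.norm_real, Real.norm_eq_abs, abs_of_nonneg hr0]
    gcongr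
  have hxm : x ∈ Metric.ball (0 : ℂ) r := mem_ball_zero_iff.2 hxr
  refine ⟨(Complex.differentiableOn_tsum_of_summable_norm hsum hdiff Metric.isOpen_ball
    hbound).differentiableAt (Metric.isOpen_ball.mem_nhds hxm), ?_⟩
  have h := Complex.hasSum_deriv_of_summable_norm hsum hdiff Metric.isOpen_ball hbound hxm
  rw [← hasSum_nat_add_iff' 1] at h
  simpa [mul_assoc, mul_left_comm] using h

/-- The coefficients of the Gauss hypergeometric series. -/
noncomputable def hyp2F1Coeff (a b c : ℂ) (d : ℕ) : ℂ :=
  (ascPochhammer ℂ d).eval a * (ascPochhammer ℂ d).eval b /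
    ((ascPochhammer ℂ d).eval c * (d.factorial : ℂ))

lemma hyp2F1Coeff_succ {a b c : ℂ} {n : ℕ} (hc : c + n ≠ 0) :
    (n + 1) * (c + n) * hyp2F1Coeff a b c (n + 1) =
      (a + n) * (b + n) * hyp2F1Coeff a b c n := by
  have h1 : (n : ℂ) + 1 ≠ 0 := by exact_mod_cast n.succ_ne_zero
  simp only [hyp2F1Coeff, ascPochhammer_succ_eval, Nat.factorial_succ, Nat.cast_mul,
    Nat.cast_succ, div_eq_mul_inv, mul_inv]
  field_simp

lemma summable_hyp2F1Coeff_mul_pow {a b c : ℂ} (hc : ∀ m : ℕ, c ≠ -(m : ℂ)) {x : ℂ}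
    (hx : ‖x‖ < 1) : Summable fun n => hyp2F1Coeff a b c n * x ^ n := by
  obtain ⟨r, hxr, hr⟩ := exists_between hx
  have hcn : ∀ n : ℕ, c + n ≠ 0 := fun n h => hc n (eq_neg_of_add_eq_zero_left h)
  have hlim : Tendsto (fun n : ℕ => ‖(a + n) / (c + n) * ((b + n) / (1 + n)) * x‖) atTop
      (𝓝 ‖x‖) := by
    have h1 : Tendsto (fun n : ℕ => (a + n) / (c + n)) atTop (𝓝 1) := by
      simpa using tendsto_add_mul_div_add_mul_atTop_nhds a c (1 : ℂ) one_ne_zero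
    have h2 : Tendsto (fun n : ℕ => (b + n) / (1 + n)) atTop (𝓝 1) := by
      simpa using tendsto_add_mul_div_add_mul_atTop_nhds b 1 (1 : ℂ) one_ne_zero
    simpa using ((h1.mul h2).mul_const x).norm
  refine summable_of_ratio_norm_eventually_le hr ?_
  filter_upwards [hlim.eventually_le_const hxr] with n hn
  have h1 : (1 : ℂ) + n ≠ 0 := by exact_mod_cast (by omega : 1 + n ≠ 0)
  have hstep : hyp2F1Coeff a b c (n + 1) * x ^ (n + 1) =
      (a + n) / (c + n) * ((b + n) / (1 + n)) * x * (hyp2F1Coeff a b c n * x ^ n) := by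
    have := hyp2F1Coeff_succ (a := a) (b := b) (hcn n)
    have h2 := hcn n
    field_simp
    linear_combination x ^ (n + 1) * this
  rw [hstep, norm_mul]
  gcongr

/-- The hypergeometric differential equation on the open unit disc. -/
lemma exists_hasDerivAt_hyp2F1 {a b c : ℂ} (hc : ∀ m : ℕ, c ≠ -(m : ℂ)) :
    ∃ F₁ F₂ : ℂ → ℂ, ∀ x : ℂ, ‖x‖ < 1 →
      HasDerivAt (hyp2F1 a b c) (F₁ x) x ∧ HasDerivAt F₁ (F₂ x) x ∧
      x * (1 - x) * F₂ x + (c - (a + b + 1) * x) * F₁ x - a * b * hyp2F1 a b c x = 0 := by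
  set u := hyp2F1Coeff a b c with hu_def
  have hu : ∀ x : ℂ, ‖x‖ < 1 → Summable fun n => u n * x ^ n :=
    fun x => summable_hyp2F1Coeff_mul_pow hc
  have hu' : ∀ x : ℂ, ‖x‖ < 1 → Summable fun n : ℕ => ((n + 1) * u (n + 1)) * x ^ n :=
    fun x hx => (hasSum_deriv_tsum_mul_pow hu hx).2.summable
  have hF : hyp2F1 a b c = fun y => ∑' n, u n * y ^ n := rfl
  set F₁ : ℂ → ℂ := fun y => ∑' n : ℕ, ((n + 1) * u (n + 1)) * y ^ n with hF₁
  refine ⟨F₁, deriv F₁, fun x hx => ?_⟩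
  obtain ⟨hd, hs⟩ := hasSum_deriv_tsum_mul_pow hu hx
  obtain ⟨hd', hs'⟩ := hasSum_deriv_tsum_mul_pow
    (u := fun n : ℕ => (n + 1) * u (n + 1)) hu' hx
  rw [← hF] at hd hs
  rw [← hF₁] at hd' hs'
  have hderiv : deriv (hyp2F1 a b c) x = F₁ x := hs.tsum_eq.symm
  rw [hderiv] at hs
  refine ⟨hderiv ▸ hd.hasDerivAt, hd'.hasDerivAt, ?_⟩
  have hs0 : HasSum (fun n => u n * x ^ n) (hyp2F1 a b c x) := (hu x hx).hasSum
  have hxF₁ : HasSum (fun n : ℕ => n * u n * x ^ n) (x * F₁ x) := by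
    rw [← hasSum_nat_add_iff' 1]
    convert! hs.mul_left x using 1
    · ext n; push_cast; ring
    · simp
  have hxF₂ : HasSum (fun n : ℕ => n * ((n + 1) * u (n + 1)) * x ^ n) (x * deriv F₁ x) := by
    rw [← hasSum_nat_add_iff' 1]
    convert! hs'.mul_left x using 1
    · ext n; push_cast; ring
    · simp
  have hxxF₂ : HasSum (fun n : ℕ => n * (n - 1) * u n * x ^ n) (x * (x * deriv F₁ x)) := by
    rw [← hasSum_nat_add_iff' 1]
    convert! hxF₂.mul_left x using 1
    · ext n; push_cast; ring
    · simp
  have hl := hxF₂.add (hs.mul_left c)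
  have hr := (hxxF₂.add (hxF₁.mul_left (a + b + 1))).add (hs0.mul_left (a * b))
  have heq := hl.unique (hr.congr_fun ?_)
  · linear_combination heq
  · intro n
    have := hyp2F1Coeff_succ (a := a) (b := b) (c := c) (n := n)
      fun h => hc n (eq_neg_of_add_eq_zero_left h)
    rw [← hu_def] at this
    linear_combination x ^ n * this

lemma deriv_deriv_eq_of_hasDerivAt {A B : ℝ → ℂ} {C : ℂ} {s : Set ℝ} (hs : IsOpen s) {w : ℝ}
    (hw : w ∈ s) (hA : ∀ t ∈ s, HasDerivAt A (B t) t) (hB : HasDerivAt B C w) :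
    deriv A w = B w ∧ deriv (deriv A) w = C := by
  refine ⟨(hA w hw).deriv, ?_⟩
  have h : deriv A =ᶠ[𝓝 w] B :=
    eventually_of_mem (hs.mem_nhds hw) fun t ht => (hA t ht).deriv
  rw [h.deriv_eq, hB.deriv]

lemma hasDerivAt_ofReal_exp (w : ℝ) :
    HasDerivAt (fun t : ℝ => ((Real.exp t : ℝ) : ℂ)) ((Real.exp w : ℝ) : ℂ) w :=
  (Real.hasDerivAt_exp w).ofReal_comp

lemma hasDerivAt_ofReal_one_sub_exp (w : ℝ) :
    HasDerivAt (fun t : ℝ => ((1 - Real.exp t : ℝ) : ℂ)) (-((Real.exp w : ℝ) : ℂ)) w := by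
  simpa using ((Real.hasDerivAt_exp w).const_sub 1).ofReal_comp

lemma hasDerivAt_cexp_mul_log_one_sub_exp (k : ℂ) {w : ℝ} (hw : w < 0) :
    HasDerivAt (fun t : ℝ => Complex.exp (k * ((Real.log (1 - Real.exp t) : ℝ) : ℂ)))
      (Complex.exp (k * ((Real.log (1 - Real.exp w) : ℝ) : ℂ)) *
        (k * (-((Real.exp w : ℝ) : ℂ) / ((1 - Real.exp w : ℝ) : ℂ)))) w := by
  have hne : 1 - Real.exp w ≠ 0 := (sub_pos.2 (Real.exp_lt_one_iff.2 hw)).ne'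
  have h := (((Real.hasDerivAt_exp w).const_sub 1).log hne).ofReal_comp
  simpa using (h.const_mul k).cexp

lemma solA₁_ode (Δp Δm : ℂ) {w : ℝ} (hw : w < 0) :
    deriv (deriv (solA₁ Δp Δm)) w =
      ((Real.exp w / (1 - Real.exp w) : ℝ) : ℂ) *
        (Δp * Δm * solA₁ Δp Δm w - (Δp + Δm) * deriv (solA₁ Δp Δm) w) := by
  obtain ⟨F₁, F₂, hF⟩ := exists_hasDerivAt_hyp2F1 (a := -Δp) (b := -Δm) (c := 1) fun m h => by
    have : (1 + m : ℂ) = 0 := by rw [h]; ring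
    exact absurd this (by exact_mod_cast (by omega : 1 + m ≠ 0))
  have hnorm : ∀ t < (0 : ℝ), ‖((Real.exp t : ℝ) : ℂ)‖ < 1 := fun t ht => by
    rw [Complex.norm_real, Real.norm_eq_abs, Real.abs_exp]
    exact Real.exp_lt_one_iff.2 ht
  have hA : ∀ t ∈ Set.Iio (0 : ℝ), HasDerivAt (solA₁ Δp Δm)
      (F₁ ((Real.exp t : ℝ) : ℂ) * ((Real.exp t : ℝ) : ℂ)) t := fun t ht =>
    (hF _ (hnorm t ht)).1.comp t (hasDerivAt_ofReal_exp t)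
  have hB := ((hF _ (hnorm w hw)).2.1.comp w (hasDerivAt_ofReal_exp w)).mul
    (hasDerivAt_ofReal_exp w)
  obtain ⟨h1, h2⟩ := deriv_deriv_eq_of_hasDerivAt isOpen_Iio hw hA hB
  have hode := (hF _ (hnorm w hw)).2.2
  have hne : (1 : ℂ) - ((Real.exp w : ℝ) : ℂ) ≠ 0 := by
    exact_mod_cast (sub_pos.2 (Real.exp_lt_one_iff.2 hw)).ne'
  rw [h1, h2, solA₁]
  simp only [Function.comp_apply, Complex.ofReal_div, Complex.ofReal_sub, Complex.ofReal_one]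
  generalize ((Real.exp w : ℝ) : ℂ) = x at hode hne ⊢
  field_simp
  linear_combination x * hode

lemma solA₂_ode {P Q z Δp Δm : ℂ} (hsum : Δp + Δm = z * P / Q ^ 2)
    (hc : ∀ m : ℕ, 2 + z * P / Q ^ 2 ≠ -(m : ℂ)) {w : ℝ} (hw : w < 0) :
    deriv (deriv (solA₂ P Q z Δp Δm)) w =
      ((Real.exp w / (1 - Real.exp w) : ℝ) : ℂ) *
        (Δp * Δm * solA₂ P Q z Δp Δm w
          - (Δp + Δm) * deriv (solA₂ P Q z Δp Δm) w) := by
  obtain ⟨F₁, F₂, hF⟩ := exists_hasDerivAt_hyp2F1 (a := 1 + Δm) (b := 1 + Δp) hc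
  have hnorm : ∀ t < (0 : ℝ), ‖((1 - Real.exp t : ℝ) : ℂ)‖ < 1 := fun t ht => by
    rw [Complex.norm_real, Real.norm_eq_abs, abs_of_pos (sub_pos.2 (Real.exp_lt_one_iff.2 ht))]
    linarith [Real.exp_pos t]
  have hFA : ∀ t < (0 : ℝ), HasDerivAt _ _ t := fun t ht =>
    (hF _ (hnorm t ht)).1.comp t (hasDerivAt_ofReal_one_sub_exp t)
  have hE : ∀ t < (0 : ℝ), HasDerivAt _ _ t := fun t ht =>
    hasDerivAt_cexp_mul_log_one_sub_exp (1 + z * P / Q ^ 2) ht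
  have hA : ∀ t ∈ Set.Iio (0 : ℝ), HasDerivAt (solA₂ P Q z Δp Δm) _ t := fun t ht =>
    (hE t ht).mul (hFA t ht)
  have hne : ((1 - Real.exp w : ℝ) : ℂ) ≠ 0 := by
    exact_mod_cast (sub_pos.2 (Real.exp_lt_one_iff.2 hw)).ne'
  have hquot := ((hasDerivAt_ofReal_exp w).neg.div (hasDerivAt_ofReal_one_sub_exp w)
    hne).const_mul (1 + z * P / Q ^ 2)
  have hB := (((hE w hw).mul hquot).mul (hFA w hw)).add ((hE w hw).mul
    (((hF _ (hnorm w hw)).2.1.comp w (hasDerivAt_ofReal_one_sub_exp w)).mul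
      (hasDerivAt_ofReal_exp w).neg))
  obtain ⟨h1, h2⟩ := deriv_deriv_eq_of_hasDerivAt isOpen_Iio hw hA hB
  have hode := (hF _ (hnorm w hw)).2.2
  have hx : ((Real.exp w : ℝ) : ℂ) = 1 - ((1 - Real.exp w : ℝ) : ℂ) := by push_cast; ring
  rw [h1, h2, solA₂]
  simp only [Function.comp_apply, Complex.ofReal_div, Pi.mul_apply, Pi.neg_apply, Pi.div_apply]
  rw [hx]
  generalize Complex.exp _ = E
  generalize ((1 - Real.exp w : ℝ) : ℂ) = y at hode hne ⊢
  rw [← hsum] at hode ⊢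
  field_simp
  linear_combination (1 - y) * E * y * hode

theorem hypergeometric_solutions_fuchsian_ODE (P Q z Δp Δm : ℂ) (hQ : Q ≠ 0)
    (hsum : Δp + Δm = z * P / Q ^ 2) (hprod : Δp * Δm = z ^ 2 / Q) :
    (∀ w < (0 : ℝ),
      deriv (deriv (solA₁ Δp Δm)) w =
        ((Real.exp w / (1 - Real.exp w) : ℝ) : ℂ) *
          ((z ^ 2 / Q) * solA₁ Δp Δm w - (P * z / Q ^ 2) * deriv (solA₁ Δp Δm) w)) ∧
    ((∀ m : ℕ, 2 + z * P / Q ^ 2 ≠ -(m : ℂ)) →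
      ∀ w < (0 : ℝ),
        deriv (deriv (solA₂ P Q z Δp Δm)) w =
          ((Real.exp w / (1 - Real.exp w) : ℝ) : ℂ) *
            ((z ^ 2 / Q) * solA₂ P Q z Δp Δm w
              - (P * z / Q ^ 2) * deriv (solA₂ P Q z Δp Δm) w)) := by
  rw [← hprod, mul_comm P z, ← hsum]
  refine ⟨fun w hw => solA₁_ode Δp Δm hw, fun hc w hw => solA₂_ode hsum (hsum ▸ hc) hw⟩
end

section
/- Let λ₁, λ₂ be nonzero real numbers and z a real number with 1 + zλ₁ > 0 and 1 + zλ₂ > 0 (hence also 2 + z(λ₁+λ₂) > 0). Define c^w₁ := −z[ψ(1+zλ₁) + ψ(1+zλ₂) + 2γ] and c^w₂ := −z Γ(1+zλ₁) Γ(1+zλ₂)/Γ(2+z(λ₁+λ₂)), where Γ is the Gamma function, ψ(x) := Γ′(x)/Γ(x) is the digamma function, and γ is the Euler–Mascheroni constant. Define for w < 0: A^w(w) := c^w₁ · ₂F₁(−zλ₁, −zλ₂; 1; e^w) + c^w₂ · (1−e^w)^{z(λ₁+λ₂)+1} · ₂F₁(1+zλ₁, 1+zλ₂; 2+z(λ₁+λ₂);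 1−e^w). Then A^w(w) − z w → 0 as w → −∞. -/
/-- The Gauss hypergeometric series `₂F₁(a,b;c;x)` over `ℝ`, defined via Pochhammer symbols. -/
noncomputable def hyp2F1R (a b c x : ℝ) : ℝ :=
  ∑' d : ℕ, ((ascPochhammer ℝ d).eval a * (ascPochhammer ℝ d).eval b /
    ((ascPochhammer ℝ d).eval c * (d.factorial : ℝ))) * x ^ d

/-- The digamma function `ψ(x) = Γ′(x)/Γ(x)`. -/
noncomputable def digamma (x : ℝ) : ℝ := deriv Real.Gamma x / Real.Gamma x

open Filter Topology

lemma Real.Gamma_add_natCast_eq_mul_ascPochhammer {s : ℝ} (hs : 0 < s) (n : ℕ) :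
    Real.Gamma (s + n) = Real.Gamma s * (ascPochhammer ℝ n).eval s := by
  induction n with
  | zero => simp
  | succ n ih =>
    have h : s + ((n + 1 : ℕ) : ℝ) = s + n + 1 := by push_cast; ring
    rw [h, Real.Gamma_add_one (by positivity), ih, ascPochhammer_succ_eval]
    ring

lemma Real.GammaSeq_mul_Gamma {s : ℝ} (hs : 0 < s) (n : ℕ) :
    Real.GammaSeq s n * Real.Gamma (s + n + 1) = n ^ s * n.factorial * Real.Gamma s := by
  have hprod : ∀ m : ℕ, (∏ j ∈ Finset.range m, (s + j)) * Real.Gamma s = Real.Gamma (s + m) := by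
    intro m
    induction m with
    | zero => simp
    | succ m ih =>
      have h : s + ((m + 1 : ℕ) : ℝ) = s + m + 1 := by push_cast; ring
      rw [Finset.prod_range_succ, h, Real.Gamma_add_one (by positivity), ← ih]
      ring
  have h := hprod (n + 1)
  push_cast at h
  have hne : ∏ j ∈ Finset.range (n + 1), (s + j) ≠ 0 :=
    Finset.prod_ne_zero_iff.2 fun j _ => by positivity
  rw [Real.GammaSeq, add_assoc, ← h]
  field_simp

lemma Real.tendsto_Gamma_add_natCast_div {s : ℝ} (hs : 0 < s) :
    Tendsto (fun n : ℕ => Real.Gamma (s + n + 1) / (n ^ s * n.factorial)) atTop (𝓝 1) := by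
  have hΓ := (Real.Gamma_pos_of_pos hs).ne'
  have h := (tendsto_const_nhds (x := Real.Gamma s)).div (Real.GammaSeq_tendsto_Gamma s) hΓ
  rw [div_self hΓ] at h
  refine h.congr' ?_
  filter_upwards [eventually_gt_atTop 0] with n hn
  have hn' : (0 : ℝ) < n := by exact_mod_cast hn
  have hp : (0 : ℝ) < n ^ s * n.factorial := by positivity
  have hseq := Real.GammaSeq_mul_Gamma hs n
  have hne : Real.GammaSeq s n ≠ 0 := by
    intro h0
    rw [h0, zero_mul] at hseq
    exact (mul_pos hp (Real.Gamma_pos_of_pos hs)).ne hseq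
  rw [Pi.div_apply, div_eq_div_iff hne hp.ne']
  linarith

lemma Real.Gamma_mul_Gamma_add_le {x y b : ℝ} (hx : 0 < x) (hxy : x ≤ y) (hb : 0 < b) :
    Real.Gamma y * Real.Gamma (x + b) ≤ Real.Gamma x * Real.Gamma (y + b) := by
  have hs : 0 < y - x + b := by linarith
  have hy : 0 < y := by linarith
  have hyb : 0 < y + b := by linarith
  have hxb : 0 < x + b := by linarith
  have hsum : b / (y - x + b) + (y - x) / (y - x + b) = 1 := by field_simp; ring
  have h₁ := Real.convexOn_log_Gamma.2 (Set.mem_Ioi.2 hx) (Set.mem_Ioi.2 hyb)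
    (show 0 ≤ b / (y - x + b) by positivity)
    (show 0 ≤ (y - x) / (y - x + b) from div_nonneg (by linarith) hs.le) hsum
  have h₂ := Real.convexOn_log_Gamma.2 (Set.mem_Ioi.2 hx) (Set.mem_Ioi.2 hyb)
    (show 0 ≤ (y - x) / (y - x + b) from div_nonneg (by linarith) hs.le)
    (show 0 ≤ b / (y - x + b) by positivity) (by rw [add_comm, hsum])
  have e₁ : b / (y - x + b) * x + (y - x) / (y - x + b) * (y + b) = y := by field_simp; ring
  have e₂ : (y - x) / (y - x + b) * x + b / (y - x + b) * (y + b) = x + b := by field_simp; ring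
  simp only [smul_eq_mul, Function.comp_apply, e₁, e₂] at h₁ h₂
  have h := add_le_add h₁ h₂
  have e₃ : ∀ p q : ℝ, b / (y - x + b) * p + (y - x) / (y - x + b) * q +
      ((y - x) / (y - x + b) * p + b / (y - x + b) * q) = p + q := by
    intro p q
    linear_combination (p + q) * hsum
  have hΓ := fun {t : ℝ} (ht : 0 < t) => Real.Gamma_pos_of_pos ht
  rw [e₃, ← Real.log_mul (hΓ hy).ne' (hΓ hxb).ne', ← Real.log_mul (hΓ hx).ne' (hΓ hyb).ne'] at h
  exact (Real.log_le_log_iff (mul_pos (hΓ hy) (hΓ hxb)) (mul_pos (hΓ hx) (hΓ hyb))).1 h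

lemma digamma_eq_deriv_log_Gamma {x : ℝ} (hx : 0 < x) :
    digamma x = deriv (Real.log ∘ Real.Gamma) x := by
  have hd : DifferentiableAt ℝ Real.Gamma x := Real.differentiableAt_Gamma fun m => by
    have : (0 : ℝ) ≤ m := m.cast_nonneg
    linarith
  exact (hd.hasDerivAt.log (Real.Gamma_pos_of_pos hx).ne').deriv.symm

lemma monotoneOn_digamma : MonotoneOn digamma (Set.Ioi 0) := by
  have h := Real.convexOn_log_Gamma.monotoneOn_deriv fun x hx => by
    have hx' : 0 < x := hx
    refine (Real.differentiableAt_Gamma fun m => ?_).log (Real.Gamma_pos_of_pos hx').ne'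
    have : (0 : ℝ) ≤ m := m.cast_nonneg
    linarith
  intro x hx y hy hxy
  rw [digamma_eq_deriv_log_Gamma hx, digamma_eq_deriv_log_Gamma hy]
  exact h hx hy hxy

lemma digamma_add_one {x : ℝ} (hx : 0 < x) : digamma (x + 1) = digamma x + 1 / x := by
  have hd : ∀ y : ℝ, 0 < y → DifferentiableAt ℝ Real.Gamma y := fun y hy =>
    Real.differentiableAt_Gamma fun m => by
      have : (0 : ℝ) ≤ m := m.cast_nonneg
      linarith
  have h₁ : HasDerivAt (fun y => Real.Gamma (y + 1)) (deriv Real.Gamma (x + 1)) x :=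
    HasDerivAt.comp_add_const x 1 (hd (x + 1) (by linarith)).hasDerivAt
  have h₂ := (hasDerivAt_id x).mul (hd x hx).hasDerivAt
  have h₃ : (fun y => Real.Gamma (y + 1)) =ᶠ[𝓝 x] id * Real.Gamma := by
    filter_upwards [eventually_ne_nhds hx.ne'] with y hy
    simp [Real.Gamma_add_one hy]
  have h := h₁.unique (h₂.congr_of_eventuallyEq h₃)
  have hΓ := (Real.Gamma_pos_of_pos hx).ne'
  have hx' := hx.ne'
  rw [digamma, digamma, h, Real.Gamma_add_one hx']
  simp only [id]
  field_simp
  ring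

lemma digamma_one : digamma 1 = -Real.eulerMascheroniConstant := by
  rw [digamma, Real.eulerMascheroniConstant_eq_neg_deriv, Real.Gamma_one]
  simp

/-- A monotone solution on `(0, ∞)` of `f (x + 1) = f x + 1 / x` is unique up to a constant. -/
lemma sub_eq_sub_of_monotoneOn_of_add_one {f g : ℝ → ℝ}
    (hf : MonotoneOn f (Set.Ioi 0)) (hg : MonotoneOn g (Set.Ioi 0))
    (hf' : ∀ x, 0 < x → f (x + 1) = f x + 1 / x) (hg' : ∀ x, 0 < x → g (x + 1) = g x + 1 / x)
    {x : ℝ} (hx : 0 < x) : f x - g x = f 1 - g 1 := by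
  have lim : ∀ f : ℝ → ℝ, MonotoneOn f (Set.Ioi 0) → (∀ x, 0 < x → f (x + 1) = f x + 1 / x) →
      ∀ y, 0 < y → Tendsto (fun n : ℕ => f (y + (n + 1 : ℕ)) - f (n + 1 : ℕ)) atTop (𝓝 0) := by
    intro f hf hf' y hy
    have hN : ∀ N : ℕ,
        Tendsto (fun n : ℕ => f (N + (n + 1 : ℕ)) - f (n + 1 : ℕ)) atTop (𝓝 0) := by
      intro N
      induction N with
      | zero => simp
      | succ N ih =>
        have h0 : Tendsto (fun n : ℕ => 1 / ((N : ℝ) + (n + 1 : ℕ))) atTop (𝓝 0) := by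
          have := (tendsto_one_div_add_atTop_nhds_zero_nat (𝕜 := ℝ)).comp (tendsto_add_atTop_nat N)
          refine this.congr fun n => ?_
          simp only [Function.comp_apply]
          push_cast
          ring_nf
        have h := ih.add h0
        rw [add_zero] at h
        refine h.congr fun n => ?_
        have e : ((N + 1 : ℕ) : ℝ) + (n + 1 : ℕ) = N + (n + 1 : ℕ) + 1 := by push_cast; ring
        rw [e, hf' _ (by positivity)]
        ring
    refine tendsto_of_tendsto_of_tendsto_of_le_of_le tendsto_const_nhds (hN ⌈y⌉₊) ?_ ?_
    · intro n
      have : (0 : ℝ) < (n + 1 : ℕ) := by positivity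
      exact sub_nonneg.2 (hf this (by simp only [Set.mem_Ioi]; positivity) (by linarith))
    · intro n
      have hc := Nat.le_ceil y
      exact sub_le_sub_right (hf (by simp only [Set.mem_Ioi]; positivity)
        (by simp only [Set.mem_Ioi]; positivity) (by linarith)) _
  have shift : ∀ y, 0 < y → ∀ n : ℕ, f (y + n) - g (y + n) = f y - g y := by
    intro y hy n
    induction n with
    | zero => simp
    | succ n ih =>
      have e : y + ((n + 1 : ℕ) : ℝ) = y + n + 1 := by push_cast; ring
      rw [e, hf' _ (by positivity), hg' _ (by positivity)]
      linarith
  have h := (lim f hf hf' x hx).sub (lim g hg hg' x hx)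
  rw [sub_zero] at h
  have hconst : ∀ n : ℕ, f (x + (n + 1 : ℕ)) - f (n + 1 : ℕ) -
      (g (x + (n + 1 : ℕ)) - g (n + 1 : ℕ)) = f x - g x - (f 1 - g 1) := by
    intro n
    have h₁ := shift x hx (n + 1)
    have h₂ := shift 1 one_pos n
    have e : ((n + 1 : ℕ) : ℝ) = 1 + n := by push_cast; ring
    rw [← e] at h₂
    linarith
  simp only [hconst] at h
  linarith [tendsto_nhds_unique h tendsto_const_nhds]

/-- The coefficients of `B(a, b) ₂F₁(a, b; a + b; x)`. -/
noncomputable def zeroBalancedCoeff (a b : ℝ) (d : ℕ) : ℝ :=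
  Real.Gamma (a + d) * Real.Gamma (b + d) / (Real.Gamma (a + b + d) * d.factorial)

lemma zeroBalancedCoeff_pos {a b : ℝ} (ha : 0 < a) (hb : 0 < b) (d : ℕ) :
    0 < zeroBalancedCoeff a b d := by
  have h₁ := Real.Gamma_pos_of_pos (show 0 < a + d by positivity)
  have h₂ := Real.Gamma_pos_of_pos (show 0 < b + d by positivity)
  have h₃ := Real.Gamma_pos_of_pos (show 0 < a + b + d by positivity)
  unfold zeroBalancedCoeff
  positivity

lemma zeroBalancedCoeff_comm (a b : ℝ) (d : ℕ) :
    zeroBalancedCoeff a b d = zeroBalancedCoeff b a d := by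
  rw [zeroBalancedCoeff, zeroBalancedCoeff, add_comm b a, mul_comm (Real.Gamma (a + d))]

lemma zeroBalancedCoeff_one_one (d : ℕ) : zeroBalancedCoeff 1 1 d = 1 / (d + 1) := by
  have e : (1 : ℝ) + 1 + d = 1 + d + 1 := by ring
  rw [zeroBalancedCoeff, e, Real.Gamma_add_one (by positivity), add_comm (1 : ℝ) d,
    Real.Gamma_nat_eq_factorial]
  have : (d.factorial : ℝ) ≠ 0 := by positivity
  field_simp

lemma zeroBalancedCoeff_succ {a b : ℝ} (ha : 0 < a) (hb : 0 < b) (d : ℕ) :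
    (d + 1) * zeroBalancedCoeff a b (d + 1) =
      d * zeroBalancedCoeff a b d + a * b * zeroBalancedCoeff a b d / (a + b + d) := by
  have e : ∀ s : ℝ, s + ((d + 1 : ℕ) : ℝ) = s + d + 1 := fun s => by push_cast; ring
  have h₃ := (Real.Gamma_pos_of_pos (show 0 < a + b + d by positivity)).ne'
  have hf : (d.factorial : ℝ) ≠ 0 := by positivity
  have hd : a + b + d ≠ 0 := by positivity
  simp only [zeroBalancedCoeff, e]
  rw [Real.Gamma_add_one (by positivity), Real.Gamma_add_one (by positivity),
    Real.Gamma_add_one hd, Nat.factorial_succ]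
  push_cast
  field_simp
  ring

lemma zeroBalancedCoeff_add_one {a b : ℝ} (ha : 0 < a) (hb : 0 < b) (d : ℕ) :
    zeroBalancedCoeff a b d - zeroBalancedCoeff (a + 1) b d =
      b * zeroBalancedCoeff a b d / (a + b + d) := by
  have h₃ := (Real.Gamma_pos_of_pos (show 0 < a + b + d by positivity)).ne'
  have hf : (d.factorial : ℝ) ≠ 0 := by positivity
  have hd : a + b + d ≠ 0 := by positivity
  have e₁ : a + 1 + d = a + d + 1 := by ring
  have e₂ : a + 1 + b + d = a + b + d + 1 := by ring
  rw [zeroBalancedCoeff, zeroBalancedCoeff, e₁, e₂, Real.Gamma_add_one (by positivity),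
    Real.Gamma_add_one hd]
  field_simp
  ring

lemma zeroBalancedCoeff_antitone {a a' b : ℝ} (ha : 0 < a) (haa' : a ≤ a') (hb : 0 < b) (d : ℕ) :
    zeroBalancedCoeff a' b d ≤ zeroBalancedCoeff a b d := by
  have ha' : 0 < a' := by linarith
  have h₁ := Real.Gamma_pos_of_pos (show 0 < a' + b + d by positivity)
  have h₂ := Real.Gamma_pos_of_pos (show 0 < b + d by positivity)
  have h₃ := Real.Gamma_pos_of_pos (show 0 < a + b + d by positivity)
  have h := Real.Gamma_mul_Gamma_add_le (show 0 < a + d by positivity)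
    (show a + d ≤ a' + d by linarith) hb
  have e : ∀ s : ℝ, s + d + b = s + b + d := fun s => by ring
  rw [e, e] at h
  unfold zeroBalancedCoeff
  rw [div_le_div_iff₀ (by positivity) (by positivity)]
  have := mul_le_mul_of_nonneg_right h (show 0 ≤ Real.Gamma (b + d) * d.factorial by positivity)
  linarith

lemma tendsto_mul_zeroBalancedCoeff {a b : ℝ} (ha : 0 < a) (hb : 0 < b) :
    Tendsto (fun d : ℕ => ((d : ℝ) + 1) * zeroBalancedCoeff a b (d + 1)) atTop (𝓝 1) := by
  have h := ((Real.tendsto_Gamma_add_natCast_div ha).mul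
    (Real.tendsto_Gamma_add_natCast_div hb)).div
    (Real.tendsto_Gamma_add_natCast_div (add_pos ha hb)) one_ne_zero
  rw [mul_one, div_one] at h
  refine h.congr' ?_
  filter_upwards [eventually_gt_atTop 0] with n hn
  have hn' : (0 : ℝ) < n := by exact_mod_cast hn
  have e : ∀ s : ℝ, s + ((n + 1 : ℕ) : ℝ) = s + n + 1 := fun s => by push_cast; ring
  have h₃ := (Real.Gamma_pos_of_pos (show 0 < a + b + n + 1 by positivity)).ne'
  have hf : (n.factorial : ℝ) ≠ 0 := by positivity
  have hpa := (Real.rpow_pos_of_pos hn' a).ne'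
  have hpb := (Real.rpow_pos_of_pos hn' b).ne'
  simp only [Pi.div_apply, zeroBalancedCoeff, e, Nat.factorial_succ]
  rw [Real.rpow_add hn']
  push_cast
  field_simp

lemma mul_zeroBalancedCoeff_le_one {a b : ℝ} (ha : 0 < a) (hb : 0 < b) (d : ℕ) :
    ((d : ℝ) + 1) * zeroBalancedCoeff a b (d + 1) ≤ 1 := by
  refine Monotone.ge_of_tendsto (f := fun d : ℕ => ((d : ℝ) + 1) * zeroBalancedCoeff a b (d + 1))
    (monotone_nat_of_le_succ fun n => ?_) (tendsto_mul_zeroBalancedCoeff ha hb) d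
  have h := zeroBalancedCoeff_succ ha hb (n + 1)
  have hp := zeroBalancedCoeff_pos ha hb (n + 1)
  have : 0 ≤ a * b * zeroBalancedCoeff a b (n + 1) / (a + b + (n + 1 : ℕ)) := by positivity
  push_cast at h this ⊢
  linarith

lemma one_sub_le_mul_zeroBalancedCoeff {a b : ℝ} (ha : 0 < a) (hb : 0 < b) (d : ℕ) :
    1 - (a * b / (a + b) + a * b) / (d + 1) ≤ ((d : ℝ) + 1) * zeroBalancedCoeff a b (d + 1) := by
  set K := a * b / (a + b) + a * b with hK
  have hlim : Tendsto (fun d : ℕ => 1 - K * (1 / ((d : ℝ) + 1)) -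
      ((d : ℝ) + 1) * zeroBalancedCoeff a b (d + 1)) atTop (𝓝 0) := by
    have := ((tendsto_one_div_add_atTop_nhds_zero_nat (𝕜 := ℝ)).const_mul K).const_sub 1
    simpa using this.sub (tendsto_mul_zeroBalancedCoeff ha hb)
  have hmono := Monotone.ge_of_tendsto (monotone_nat_of_le_succ fun n => ?_) hlim d
  · rw [mul_one_div] at hmono
    linarith
  have h := zeroBalancedCoeff_succ ha hb (n + 1)
  have hle := mul_zeroBalancedCoeff_le_one ha hb n
  have hKn : a * b * (n + 2) ≤ K * (a + b + (n + 1)) := by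
    have e : K * (a + b + (n + 1)) =
        a * b * (n + 2) + a * b * (n + 1) / (a + b) + a * b * (a + b) := by
      rw [hK]
      field_simp
      ring
    rw [e]
    have : 0 ≤ a * b * (n + 1) / (a + b) + a * b * (a + b) := by positivity
    linarith
  have hstep : a * b * zeroBalancedCoeff a b (n + 1) / (a + b + (n + 1)) ≤
      K * (1 / ((n : ℝ) + 1)) - K * (1 / ((n : ℝ) + 1 + 1)) := by
    have e : K * (1 / ((n : ℝ) + 1)) - K * (1 / ((n : ℝ) + 1 + 1)) = K / ((n + 1) * (n + 2)) := by
      field_simp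
      ring
    rw [e, div_le_div_iff₀ (by positivity) (by positivity)]
    calc a * b * zeroBalancedCoeff a b (n + 1) * ((n + 1) * (n + 2))
        = (a * b * (n + 2)) * ((n + 1) * zeroBalancedCoeff a b (n + 1)) := by ring
      _ ≤ (a * b * (n + 2)) * 1 := mul_le_mul_of_nonneg_left hle (by positivity)
      _ ≤ K * (a + b + (n + 1)) := by rw [mul_one]; exact hKn
  push_cast at h ⊢
  linarith

lemma summable_zeroBalancedCoeff_sub {a b : ℝ} (ha : 0 < a) (hb : 0 < b) :
    Summable fun d : ℕ => zeroBalancedCoeff a b d - 1 / (d + 1) := by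
  rw [← summable_nat_add_iff 1]
  set K := a * b / (a + b) + a * b
  have hs : Summable fun d : ℕ => 1 / ((d + 1 : ℕ) : ℝ) ^ 2 :=
    (summable_nat_add_iff 1).2 (Real.summable_one_div_nat_pow.2 one_lt_two)
  refine Summable.of_norm_bounded (hs.mul_left (K + 1)) fun d => ?_
  have h₁ := mul_zeroBalancedCoeff_le_one ha hb d
  have h₂ := one_sub_le_mul_zeroBalancedCoeff ha hb d
  have hK : 0 ≤ K := by positivity
  have hc : zeroBalancedCoeff a b (d + 1) =
      (((d : ℝ) + 1) * zeroBalancedCoeff a b (d + 1)) / (d + 1) := by field_simp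
  rw [hc]
  set u := ((d : ℝ) + 1) * zeroBalancedCoeff a b (d + 1)
  have hub : u / ((d : ℝ) + 1) ≤ 1 / ((d : ℝ) + 1) := by gcongr
  have hlb : (1 - K / ((d : ℝ) + 1)) / ((d : ℝ) + 1) ≤ u / ((d : ℝ) + 1) := by gcongr
  have e₁ : (1 - K / ((d : ℝ) + 1)) / ((d : ℝ) + 1) =
      1 / ((d : ℝ) + 1) - K * (1 / ((d : ℝ) + 1) ^ 2) := by field_simp
  have e₂ : 1 / ((d : ℝ) + 1) - 1 / ((d : ℝ) + 1 + 1) ≤ 1 / ((d : ℝ) + 1) ^ 2 := by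
    have : 1 / ((d : ℝ) + 1) - 1 / ((d : ℝ) + 1 + 1) = 1 / (((d : ℝ) + 1) * (d + 1 + 1)) := by
      field_simp
      ring
    rw [this, sq]
    gcongr
    linarith
  have e₃ : 1 / ((d : ℝ) + 1 + 1) ≤ 1 / ((d : ℝ) + 1) := by gcongr; linarith
  have e₄ : 0 ≤ K * (1 / ((d : ℝ) + 1) ^ 2) := by positivity
  have e₅ : 0 ≤ 1 / ((d : ℝ) + 1) ^ 2 := by positivity
  rw [Real.norm_eq_abs, abs_le]
  push_cast
  constructor <;> linarith

/-- The regularized value at `1` of the series with coefficients `zeroBalancedCoeff a b`. -/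
noncomputable def zeroBalancedSum (a b : ℝ) : ℝ :=
  ∑' d : ℕ, (zeroBalancedCoeff a b d - 1 / (d + 1))

lemma zeroBalancedSum_comm (a b : ℝ) : zeroBalancedSum a b = zeroBalancedSum b a := by
  simp only [zeroBalancedSum, zeroBalancedCoeff_comm a b]

lemma zeroBalancedSum_one_one : zeroBalancedSum 1 1 = 0 := by
  simp [zeroBalancedSum, zeroBalancedCoeff_one_one]

lemma zeroBalancedSum_antitone {a a' b : ℝ} (ha : 0 < a) (haa' : a ≤ a') (hb : 0 < b) :
    zeroBalancedSum a' b ≤ zeroBalancedSum a b :=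
  Summable.tsum_le_tsum (fun d => sub_le_sub_right (zeroBalancedCoeff_antitone ha haa' hb d) _)
    (summable_zeroBalancedCoeff_sub (by linarith) hb) (summable_zeroBalancedCoeff_sub ha hb)

lemma zeroBalancedSum_add_one {a b : ℝ} (ha : 0 < a) (hb : 0 < b) :
    zeroBalancedSum (a + 1) b = zeroBalancedSum a b - 1 / a := by
  have hs₁ := summable_zeroBalancedCoeff_sub ha hb
  have hs₂ := summable_zeroBalancedCoeff_sub (show 0 < a + 1 by linarith) hb
  have hsum : HasSum (fun d : ℕ => zeroBalancedCoeff a b d - 1 / (d + 1) -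
      (zeroBalancedCoeff (a + 1) b d - 1 / (d + 1))) (1 / a) := by
    rw [(hs₁.sub hs₂).hasSum_iff_tendsto_nat]
    have hpart : ∀ n : ℕ, ∑ d ∈ Finset.range n, (zeroBalancedCoeff a b d - 1 / (d + 1) -
        (zeroBalancedCoeff (a + 1) b d - 1 / (d + 1))) = n * zeroBalancedCoeff a b n / a := by
      intro n
      induction n with
      | zero => simp
      | succ n ih =>
        have h := zeroBalancedCoeff_succ ha hb n
        have h' := zeroBalancedCoeff_add_one ha hb n
        rw [Finset.sum_range_succ, ih, sub_sub_sub_cancel_right, h']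
        push_cast
        rw [h]
        field_simp
    simp only [hpart]
    rw [← tendsto_add_atTop_iff_nat 1]
    simpa using (tendsto_mul_zeroBalancedCoeff ha hb).div_const a
  have h := hs₁.tsum_sub hs₂
  rw [hsum.tsum_eq] at h
  rw [zeroBalancedSum, zeroBalancedSum]
  linarith

lemma neg_zeroBalancedSum_sub_digamma {a b : ℝ} (ha : 0 < a) (hb : 0 < b) :
    -zeroBalancedSum a b - digamma a = -zeroBalancedSum 1 b - digamma 1 := by
  refine sub_eq_sub_of_monotoneOn_of_add_one (f := fun a => -zeroBalancedSum a b)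
    (fun x hx y _ hxy => neg_le_neg (zeroBalancedSum_antitone hx hxy hb)) monotoneOn_digamma
    (fun x hx => ?_) (fun x hx => digamma_add_one hx) ha
  rw [zeroBalancedSum_add_one hx hb]
  ring

theorem zeroBalancedSum_eq {a b : ℝ} (ha : 0 < a) (hb : 0 < b) :
    zeroBalancedSum a b = -(digamma a + digamma b + 2 * Real.eulerMascheroniConstant) := by
  have h₁ := neg_zeroBalancedSum_sub_digamma ha hb
  have h₂ := neg_zeroBalancedSum_sub_digamma hb one_pos
  rw [zeroBalancedSum_comm 1 b, digamma_one] at h₁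
  rw [zeroBalancedSum_one_one, digamma_one] at h₂
  linarith

lemma beta_mul_hyp2F1R {a b x : ℝ} (ha : 0 < a) (hb : 0 < b) (hx₀ : 0 < x) (hx₁ : x < 1) :
    Real.Gamma a * Real.Gamma b / Real.Gamma (a + b) * hyp2F1R a b (a + b) x =
      ∑' d : ℕ, (zeroBalancedCoeff a b d - 1 / (d + 1)) * x ^ d - Real.log (1 - x) / x := by
  have hlog : HasSum (fun d : ℕ => 1 / ((d : ℝ) + 1) * x ^ d) (-Real.log (1 - x) / x) := by
    have h := (Real.hasSum_pow_div_log_of_abs_lt_one (abs_lt.2 ⟨by linarith, hx₁⟩)).div_const x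
    refine h.congr_fun fun d => ?_
    rw [pow_succ]
    field_simp
  have hs : Summable fun d : ℕ => (zeroBalancedCoeff a b d - 1 / (d + 1)) * x ^ d := by
    refine Summable.of_norm_bounded (summable_zeroBalancedCoeff_sub ha hb).norm fun d => ?_
    rw [norm_mul, norm_pow]
    refine mul_le_of_le_one_right (norm_nonneg _) (pow_le_one₀ (norm_nonneg _) ?_)
    rw [Real.norm_eq_abs, abs_of_pos hx₀]
    exact hx₁.le
  rw [sub_eq_add_neg, ← neg_div, ← hlog.tsum_eq, ← hs.tsum_add hlog.summable, hyp2F1R,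
    ← tsum_mul_left]
  refine tsum_congr fun d => ?_
  have h₁ := (Real.Gamma_pos_of_pos (add_pos ha hb)).ne'
  have h₂ := (ascPochhammer_pos d (a + b) (add_pos ha hb)).ne'
  have h₃ : (d.factorial : ℝ) ≠ 0 := by positivity
  rw [zeroBalancedCoeff, Real.Gamma_add_natCast_eq_mul_ascPochhammer ha,
    Real.Gamma_add_natCast_eq_mul_ascPochhammer hb,
    Real.Gamma_add_natCast_eq_mul_ascPochhammer (add_pos ha hb)]
  field_simp
  ring

lemma tendsto_tsum_mul_pow {e : ℕ → ℝ} (he : Summable e) :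
    Tendsto (fun x : ℝ => ∑' d : ℕ, e d * x ^ d) (𝓝[<] 1) (𝓝 (∑' d, e d)) := by
  refine tendsto_tsum_of_dominated_convergence he.norm (fun d => ?_) ?_
  · have h : Tendsto (fun x : ℝ => e d * x ^ d) (𝓝 1) (𝓝 (e d * 1 ^ d)) :=
      (Continuous.tendsto (by fun_prop) 1)
    rw [one_pow, mul_one] at h
    exact h.mono_left nhdsWithin_le_nhds
  · filter_upwards [self_mem_nhdsWithin, nhdsWithin_le_nhds (lt_mem_nhds zero_lt_one)]
      with x hx₁ hx₀ d
    rw [norm_mul, norm_pow]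
    refine mul_le_of_le_one_right (norm_nonneg _) (pow_le_one₀ (norm_nonneg _) ?_)
    rw [Real.norm_eq_abs, abs_of_pos hx₀]
    exact le_of_lt hx₁

lemma tendsto_hyp2F1R_one_nhds_zero (α β : ℝ) :
    Tendsto (hyp2F1R α β 1) (𝓝 0) (𝓝 1) := by
  set f : ℕ → ℝ := fun d => (ascPochhammer ℝ d).eval α * (ascPochhammer ℝ d).eval β /
    ((ascPochhammer ℝ d).eval 1 * (d.factorial : ℝ)) with hf
  have hsum : Summable fun d => f d * (1 / 2 : ℝ) ^ d := by
    have hlim : ∀ γ : ℝ, Tendsto (fun n : ℕ => (γ + n) / (1 + n)) atTop (𝓝 1) := by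
      intro γ
      have h := ((tendsto_one_div_add_atTop_nhds_zero_nat (𝕜 := ℝ)).const_mul (γ - 1)).const_add 1
      rw [mul_zero, add_zero] at h
      refine h.congr fun n => ?_
      field_simp
      ring
    have h := (((hlim α).mul (hlim β)).mul_const (1 / 2)).norm
    refine summable_of_ratio_norm_eventually_le (r := 3 / 4) (by norm_num) ?_
    filter_upwards [h.eventually_le_const (show ‖(1 : ℝ) * 1 * (1 / 2)‖ < 3 / 4 by norm_num)]
      with n hn
    have e : f (n + 1) * (1 / 2) ^ (n + 1) =
        (α + n) / (1 + n) * ((β + n) / (1 + n)) * (1 / 2) * (f n * (1 / 2) ^ n) := by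
      have h₁ := (ascPochhammer_pos n (1 : ℝ) one_pos).ne'
      have h₂ : (n.factorial : ℝ) ≠ 0 := by positivity
      simp only [hf, ascPochhammer_succ_eval, Nat.factorial_succ, pow_succ]
      push_cast
      field_simp
      ring
    rw [e, norm_mul]
    exact mul_le_mul_of_nonneg_right hn (norm_nonneg _)
  have h : Tendsto (hyp2F1R α β 1) (𝓝 0) (𝓝 (∑' d : ℕ, f d * (0 : ℝ) ^ d)) := by
    refine tendsto_tsum_of_dominated_convergence hsum.norm
      (fun d => (Continuous.tendsto (by fun_prop) (0 : ℝ))) ?_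
    filter_upwards [Metric.ball_mem_nhds (0 : ℝ) one_half_pos] with x hx d
    rw [mem_ball_zero_iff] at hx
    rw [norm_mul, norm_mul, norm_pow, norm_pow]
    gcongr
    rw [Real.norm_of_nonneg one_half_pos.le]
    exact hx.le
  have h₀ : ∑' d : ℕ, f d * (0 : ℝ) ^ d = 1 := by
    rw [tsum_eq_single 0 fun d hd => by simp [hd]]
    simp [hf]
  rwa [h₀] at h

lemma tendsto_mul_one_sub_exp_rpow_sub_one (t : ℝ) :
    Tendsto (fun w : ℝ => w * ((1 - Real.exp w) ^ t - 1)) atBot (𝓝 0) := by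
  have hd : HasDerivAt (fun q : ℝ => (1 - q) ^ t) (-t) 0 := by
    have h := ((hasDerivAt_id (0 : ℝ)).const_sub 1).rpow_const (p := t) (Or.inl (by simp))
    simpa using h
  have hslope := hd.tendsto_slope_zero
  have hexp : Tendsto Real.exp atBot (𝓝[≠] 0) :=
    tendsto_nhdsWithin_of_tendsto_nhds_of_eventually_within _ Real.tendsto_exp_atBot
      (Eventually.of_forall fun w => (Real.exp_pos w).ne')
  have hw : Tendsto (fun w : ℝ => w * Real.exp w) atBot (𝓝 0) := by
    have h := ((Real.tendsto_pow_mul_exp_neg_atTop_nhds_zero 1).comp tendsto_neg_atBot_atTop).neg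
    simpa using h
  have h := hw.mul (hslope.comp hexp)
  rw [zero_mul] at h
  refine h.congr fun w => ?_
  have := (Real.exp_pos w).ne'
  simp only [Function.comp_apply, zero_add, sub_zero, Real.one_rpow, smul_eq_mul]
  field_simp

theorem conifold_flat_coordinate_asymptotics (l₁ l₂ z : ℝ) (h₁ : l₁ ≠ 0) (h₂ : l₂ ≠ 0)
    (hz₁ : 1 + z * l₁ > 0) (hz₂ : 1 + z * l₂ > 0) :
    Filter.Tendsto (fun w : ℝ =>
      ((-z * (digamma (1 + z * l₁) + digamma (1 + z * l₂)
            + 2 * Real.eulerMascheroniConstant)) *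
          hyp2F1R (-z * l₁) (-z * l₂) 1 (Real.exp w)
        + (-z * Real.Gamma (1 + z * l₁) * Real.Gamma (1 + z * l₂) /
            Real.Gamma (2 + z * (l₁ + l₂))) *
          (1 - Real.exp w) ^ (z * (l₁ + l₂) + 1) *
          hyp2F1R (1 + z * l₁) (1 + z * l₂) (2 + z * (l₁ + l₂)) (1 - Real.exp w))
      - z * w) Filter.atBot (nhds 0) := by
  set a := 1 + z * l₁ with ha
  set b := 1 + z * l₂ with hb
  have ha₀ : 0 < a := hz₁
  have hb₀ : 0 < b := hz₂
  have hab : 2 + z * (l₁ + l₂) = a + b := by rw [ha, hb]; ring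
  have hs : z * (l₁ + l₂) + 1 = a + b - 1 := by rw [ha, hb]; ring
  have hexp : Tendsto (fun w : ℝ => 1 - Real.exp w) atBot (𝓝[<] 1) := by
    refine tendsto_nhdsWithin_of_tendsto_nhds_of_eventually_within _ ?_
      (Eventually.of_forall fun w => sub_lt_self 1 (Real.exp_pos w))
    simpa using Real.tendsto_exp_atBot.const_sub 1
  have hF := (tendsto_hyp2F1R_one_nhds_zero (-z * l₁) (-z * l₂)).comp Real.tendsto_exp_atBot
  have hE := (tendsto_tsum_mul_pow (summable_zeroBalancedCoeff_sub ha₀ hb₀)).comp hexp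
  have hpow : Tendsto (fun w : ℝ => (1 - Real.exp w) ^ (a + b - 1)) atBot (𝓝 1) := by
    have h := (hexp.mono_right nhdsWithin_le_nhds).rpow_const (p := a + b - 1)
      (Or.inl one_ne_zero)
    rwa [Real.one_rpow] at h
  have hlim := ((hF.const_mul (-z * (digamma a + digamma b +
    2 * Real.eulerMascheroniConstant))).sub ((hpow.mul hE).const_mul z)).add
    ((tendsto_mul_one_sub_exp_rpow_sub_one (a + b - 1 - 1)).const_mul z)
  have hzero : -z * (digamma a + digamma b + 2 * Real.eulerMascheroniConstant) * 1 -
      z * (1 * ∑' d : ℕ, (zeroBalancedCoeff a b d - 1 / (d + 1))) + z * 0 = 0 := by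
    have h := zeroBalancedSum_eq ha₀ hb₀
    rw [zeroBalancedSum] at h
    rw [h]
    ring
  rw [hzero] at hlim
  refine hlim.congr' ?_
  filter_upwards [eventually_lt_atBot 0] with w hw
  have hq : Real.exp w < 1 := by simpa using hw
  have hx : 0 < 1 - Real.exp w := by linarith
  have hB := beta_mul_hyp2F1R ha₀ hb₀ hx (sub_lt_self 1 (Real.exp_pos w))
  rw [sub_sub_cancel, Real.log_exp] at hB
  rw [hab, hs]
  simp only [Function.comp_apply]
  rw [Real.rpow_sub_one hx.ne' (a + b - 1)]
  linear_combination z * (1 - Real.exp w) ^ (a + b - 1) * hB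
end

section
/- Let λ₁, λ₂ be real numbers and fix x with |x| < 1. Then the function φ(z) := ₂F₁(−zλ₁, −zλ₂; 1; x) = ∑_{d≥0} ((−zλ₁)_d (−zλ₂)_d/(d!)²) x^d is analytic in z near z = 0 and satisfies φ(0) = 1, φ′(0) = 0, and φ″(0) = 2 λ₁ λ₂ Li₂(x); equivalently, ₂F₁(−zλ₁, −zλ₂; 1; x) = 1 + λ₁λ₂ Li₂(x) z² + O(z³) as z → 0. -/
/-- The dilogarithm `Li₂(x) = ∑_{n≥1} xⁿ/n²`. -/
noncomputable def Li₂ (x : ℝ) : ℝ := ∑' n : ℕ, x ^ (n + 1) / ((n : ℝ) + 1) ^ 2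

/-- A Pochhammer symbol of positive length as a product of factors normalised to `1` at `w = 0`. -/
theorem ascPochhammer_succ_eval_neg {K : Type*} [Field K] [CharZero K] (n : ℕ) (w : K) :
    (ascPochhammer K (n + 1)).eval (-w) =
      -w * n.factorial * ∏ k ∈ Finset.range n, (1 - w / ((k : K) + 1)) := by
  induction n with
  | zero => simp
  | succ n ih =>
    have h : (n : K) + 1 ≠ 0 := Nat.cast_add_one_ne_zero n
    rw [ascPochhammer_succ_eval, ih, Finset.prod_range_succ, Nat.factorial_succ]
    push_cast
    field_simp
    ring

theorem norm_prod_one_sub_div_le (n : ℕ) {w : ℂ} (hw : ‖w‖ ≤ 1) :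
    ‖∏ k ∈ Finset.range n, (1 - w / ((k : ℂ) + 1))‖ ≤ (n : ℝ) + 1 := by
  induction n with
  | zero => simp
  | succ n ih =>
    have hpos : (0 : ℝ) < n + 1 := by positivity
    have hn : ‖(n : ℂ) + 1‖ = n + 1 := by
      exact_mod_cast Complex.norm_natCast (n + 1)
    have h : ‖1 - w / ((n : ℂ) + 1)‖ ≤ 1 + 1 / ((n : ℝ) + 1) := by
      refine (norm_sub_le _ _).trans ?_
      rw [norm_one, norm_div, hn]
      gcongr
    rw [Finset.prod_range_succ, norm_mul]
    calc _ ≤ ((n : ℝ) + 1) * (1 + 1 / ((n : ℝ) + 1)) := by gcongr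
      _ = _ := by push_cast; field_simp

/-- The `n`-th term of the series obtained from `₂F₁(-z l₁, -z l₂; 1; x) - 1` by dividing
by `z ^ 2`. -/
noncomputable def reducedHypTerm {K : Type*} [Field K] (l₁ l₂ x : K) (n : ℕ) (z : K) : K :=
  l₁ * l₂ * (x ^ (n + 1) / ((n : K) + 1) ^ 2) *
    ((∏ k ∈ Finset.range n, (1 - z * l₁ / ((k : K) + 1))) *
      ∏ k ∈ Finset.range n, (1 - z * l₂ / ((k : K) + 1)))

theorem reducedHypTerm_ofReal (l₁ l₂ x : ℝ) (n : ℕ) (z : ℝ) :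
    reducedHypTerm (l₁ : ℂ) l₂ x n z = (reducedHypTerm l₁ l₂ x n z : ℝ) := by
  simp [reducedHypTerm]

theorem norm_reducedHypTerm_le (l₁ l₂ x : ℂ) (n : ℕ) {z : ℂ} (h₁ : ‖z * l₁‖ ≤ 1)
    (h₂ : ‖z * l₂‖ ≤ 1) :
    ‖reducedHypTerm l₁ l₂ x n z‖ ≤ ‖l₁ * l₂‖ * ‖x‖ ^ (n + 1) := by
  have hpos : (0 : ℝ) < n + 1 := by positivity
  have hn : ‖(n : ℂ) + 1‖ = n + 1 := by
    exact_mod_cast Complex.norm_natCast (n + 1)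
  rw [reducedHypTerm, norm_mul, norm_mul (l₁ * l₂), norm_div, norm_pow, norm_pow, hn,
    norm_mul (∏ k ∈ Finset.range n, (1 - z * l₁ / ((k : ℂ) + 1)))]
  calc _ ≤ ‖l₁ * l₂‖ * (‖x‖ ^ (n + 1) / ((n : ℝ) + 1) ^ 2) * (((n : ℝ) + 1) * ((n : ℝ) + 1)) := by
        gcongr
        · exact norm_prod_one_sub_div_le n h₁
        · exact norm_prod_one_sub_div_le n h₂
    _ = _ := by field_simp

theorem summable_norm_mul_pow_succ (c x : ℂ) (hx : ‖x‖ < 1) :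
    Summable fun n : ℕ => ‖c‖ * ‖x‖ ^ (n + 1) :=
  ((summable_nat_add_iff 1).2 (summable_geometric_of_lt_one (norm_nonneg x) hx)).mul_left _

theorem exists_pos_forall_norm_mul_le_one (l₁ l₂ : ℂ) :
    ∃ r > 0, ∀ z ∈ Metric.ball (0 : ℂ) r, ‖z * l₁‖ ≤ 1 ∧ ‖z * l₂‖ ≤ 1 := by
  have h (l : ℂ) : ∀ᶠ z in nhds (0 : ℂ), ‖z * l‖ ≤ 1 := by
    have hc : ContinuousAt (fun z : ℂ => ‖z * l‖) 0 := by fun_prop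
    exact (hc.eventually_lt continuousAt_const (by simp)).mono fun _ h => le_of_lt h
  exact Metric.eventually_nhds_iff_ball.1 ((h l₁).and (h l₂))

theorem analyticAt_tsum_reducedHypTerm_complex (l₁ l₂ x : ℂ) (hx : ‖x‖ < 1) :
    AnalyticAt ℂ (fun z => ∑' n, reducedHypTerm l₁ l₂ x n z) 0 := by
  obtain ⟨r, hr, h⟩ := exists_pos_forall_norm_mul_le_one l₁ l₂
  refine (Complex.differentiableOn_tsum_of_summable_norm
    (summable_norm_mul_pow_succ (l₁ * l₂) x hx) (fun n => ?_) Metric.isOpen_ball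
    fun n z hz => norm_reducedHypTerm_le l₁ l₂ x n (h z hz).1 (h z hz).2).analyticAt
      (Metric.ball_mem_nhds 0 hr)
  unfold reducedHypTerm
  fun_prop

theorem analyticAt_tsum_reducedHypTerm (l₁ l₂ x : ℝ) (hx : |x| < 1) :
    AnalyticAt ℝ (fun z => ∑' n, reducedHypTerm l₁ l₂ x n z) 0 := by
  have h := analyticAt_tsum_reducedHypTerm_complex l₁ l₂ x (by simpa using hx)
  rw [← Complex.ofReal_zero] at h
  convert h.re_ofReal using 2 with z
  simp only [reducedHypTerm_ofReal, ← Complex.ofReal_tsum, Complex.ofReal_re]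

theorem eventually_summable_reducedHypTerm (l₁ l₂ x : ℝ) (hx : |x| < 1) :
    ∀ᶠ z in nhds (0 : ℝ), Summable fun n => reducedHypTerm l₁ l₂ x n z := by
  obtain ⟨r, hr, h⟩ := exists_pos_forall_norm_mul_le_one l₁ l₂
  filter_upwards [Metric.ball_mem_nhds (0 : ℝ) hr] with z hz
  have hz' : (z : ℂ) ∈ Metric.ball (0 : ℂ) r := by simpa using hz
  refine (summable_norm_mul_pow_succ (l₁ * l₂ : ℂ) x (by simpa using hx)).of_norm_bounded
    fun n => ?_
  simpa only [reducedHypTerm_ofReal, Complex.norm_real] using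
    norm_reducedHypTerm_le l₁ l₂ x n (h z hz').1 (h z hz').2

theorem hyp2F1R_term_succ (l₁ l₂ x z : ℝ) (n : ℕ) :
    (ascPochhammer ℝ (n + 1)).eval (-z * l₁) * (ascPochhammer ℝ (n + 1)).eval (-z * l₂) /
      ((ascPochhammer ℝ (n + 1)).eval 1 * ((n + 1).factorial : ℝ)) * x ^ (n + 1) =
      z ^ 2 * reducedHypTerm l₁ l₂ x n z := by
  have hf : (n.factorial : ℝ) ≠ 0 := Nat.cast_ne_zero.2 n.factorial_ne_zero
  have hn : (n : ℝ) + 1 ≠ 0 := Nat.cast_add_one_ne_zero n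
  rw [neg_mul, neg_mul, ascPochhammer_succ_eval_neg, ascPochhammer_succ_eval_neg,
    ascPochhammer_eval_one, Nat.factorial_succ, reducedHypTerm]
  push_cast
  generalize (∏ k ∈ Finset.range n, (1 - z * l₁ / ((k : ℝ) + 1))) = p
  generalize (∏ k ∈ Finset.range n, (1 - z * l₂ / ((k : ℝ) + 1))) = q
  field_simp

theorem hyp2F1R_eventuallyEq (l₁ l₂ x : ℝ) (hx : |x| < 1) :
    (fun z : ℝ => hyp2F1R (-z * l₁) (-z * l₂) 1 x) =ᶠ[nhds 0]
      fun z => 1 + z ^ 2 * ∑' n, reducedHypTerm l₁ l₂ x n z := by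
  filter_upwards [eventually_summable_reducedHypTerm l₁ l₂ x hx] with z hz
  rw [hyp2F1R, Summable.tsum_eq_zero_add]
  · simp only [hyp2F1R_term_succ, tsum_mul_left]
    simp
  · rw [← summable_nat_add_iff 1]
    simpa only [hyp2F1R_term_succ] using hz.mul_left (z ^ 2)

theorem tsum_reducedHypTerm_zero (l₁ l₂ x : ℝ) :
    ∑' n, reducedHypTerm l₁ l₂ x n 0 = l₁ * l₂ * Li₂ x := by
  simp [reducedHypTerm, Li₂, tsum_mul_left]

theorem deriv_one_add_sq_mul {G : ℝ → ℝ} {z : ℝ} (hG : DifferentiableAt ℝ G z) :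
    deriv (fun z => 1 + z ^ 2 * G z) z = z * (2 * G z + z * deriv G z) := by
  have h := (((hasDerivAt_id z).pow 2).mul hG.hasDerivAt).const_add 1
  refine HasDerivAt.deriv (h.congr_deriv ?_)
  simp
  ring

theorem deriv_deriv_one_add_sq_mul_zero {G : ℝ → ℝ} (hG : AnalyticAt ℝ G 0) :
    deriv (deriv fun z => 1 + z ^ 2 * G z) 0 = 2 * G 0 := by
  have h : deriv (fun z => 1 + z ^ 2 * G z) =ᶠ[nhds 0]
      fun z => z * (2 * G z + z * deriv G z) := by
    filter_upwards [hG.eventually_analyticAt] with z hz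
    exact deriv_one_add_sq_mul hz.differentiableAt
  have hG₀ := hG.differentiableAt
  have hG₁ := hG.deriv.differentiableAt
  rw [h.deriv_eq, deriv_fun_mul (by fun_prop) (by fun_prop)]
  simp

theorem hypergeometric_small_z_expansion (l₁ l₂ x : ℝ) (hx : |x| < 1) :
    AnalyticAt ℝ (fun z : ℝ => hyp2F1R (-z * l₁) (-z * l₂) 1 x) 0 ∧
    (fun z : ℝ => hyp2F1R (-z * l₁) (-z * l₂) 1 x) 0 = 1 ∧
    deriv (fun z : ℝ => hyp2F1R (-z * l₁) (-z * l₂) 1 x) 0 = 0 ∧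
    deriv (deriv (fun z : ℝ => hyp2F1R (-z * l₁) (-z * l₂) 1 x)) 0 = 2 * l₁ * l₂ * Li₂ x := by
  have hG := analyticAt_tsum_reducedHypTerm l₁ l₂ x hx
  have h := hyp2F1R_eventuallyEq l₁ l₂ x hx
  refine ⟨?_, ?_, ?_, ?_⟩
  · refine AnalyticAt.congr ?_ h.symm
    exact analyticAt_const.add ((analyticAt_id.pow 2).mul hG)
  · exact h.eq_of_nhds.trans (by simp)
  · rw [h.deriv_eq, deriv_one_add_sq_mul hG.differentiableAt, zero_mul]
  · rw [h.deriv.deriv_eq, deriv_deriv_one_add_sq_mul_zero hG, tsum_reducedHypTerm_zero]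
    ring
end

section
/- Let λ be a nonzero real number. Define on ℝ × (−∞,0) the functions h₀(v,w) := −v²/(2λ²) + Li₂(e^w) and h₁(v,w) := −v³/(6λ²) + v·Li₂(e^w). Then the pair (h₀, h₁) satisfies the deformed flatness recursion for the anti-diagonally equivariant resolved conifold, namely: ∂²h₁/∂v² = ∂h₀/∂v, ∂²h₁/∂v∂w = ∂h₀/∂w, and ∂²h₁/∂w² = −λ² (e^w/(1−e^w)) ∂h₀/∂v, these being the equations ∂²h₁/∂u^α∂u^β = c^γ_{αβ} ∂h₀/∂u^γ for the structure constants c^γ_{αβ} = η^{γδ} ∂³F₀/∂u^δ∂u^α∂u^β associated with the prepotential F₀(v,w) = −v²w/(2λ²) + Li₃(e^w) and metric η = [[0, −1/λ²],[−1/λ², 0]]. -/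
/-- `h₀(v,w) = −v²/(2λ²) + Li₂(e^w)`, the density of the `t^{2,0}`-flow. -/
noncomputable def h₀ (lam v w : ℝ) : ℝ := -v ^ 2 / (2 * lam ^ 2) + Li₂ (Real.exp w)

/-- `h₁(v,w) = −v³/(6λ²) + v·Li₂(e^w)`, the density of the `t^{2,1}`-flow. -/
noncomputable def h₁ (lam v w : ℝ) : ℝ := -v ^ 3 / (6 * lam ^ 2) + v * Li₂ (Real.exp w)

open Real Set in
/-- In the logarithmic variable, `Li₂` is a primitive of `Li₁(x) = -log (1 - x)`. -/
theorem hasDerivAt_Li₂_exp {w : ℝ} (hw : w < 0) :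
    HasDerivAt (fun s => Li₂ (exp s)) (-log (1 - exp w)) w := by
  obtain ⟨b, hwb, hb⟩ := exists_between hw
  have hterm (n : ℕ) (y : ℝ) : HasDerivAt (fun s => exp s ^ (n + 1) / ((n : ℝ) + 1) ^ 2)
      (exp y ^ (n + 1) / ((n : ℝ) + 1)) y := by
    have hn : (n : ℝ) + 1 ≠ 0 := by positivity
    refine (((hasDerivAt_exp y).pow (n + 1)).div_const (((n : ℝ) + 1) ^ 2)).congr_deriv ?_
    push_cast
    field_simp
    ring
  have hlog : HasSum (fun n : ℕ => exp w ^ (n + 1) / ((n : ℝ) + 1)) (-log (1 - exp w)) :=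
    hasSum_pow_div_log_of_abs_lt_one (by rwa [abs_exp, exp_lt_one_iff])
  have hgeom : Summable fun n : ℕ => exp b ^ (n + 1) :=
    (summable_nat_add_iff 1).2 (summable_geometric_of_lt_one (exp_pos b).le (exp_lt_one_iff.2 hb))
  have hsum : Summable fun n : ℕ => exp w ^ (n + 1) / ((n : ℝ) + 1) ^ 2 := by
    refine hlog.summable.of_nonneg_of_le (fun n => by positivity) fun n => ?_
    have hn : (1 : ℝ) ≤ (n : ℝ) + 1 := by linarith [n.cast_nonneg (α := ℝ)]
    gcongr
    exact le_self_pow₀ hn two_ne_zero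
  have hder := hasDerivAt_tsum_of_isPreconnected hgeom isOpen_Iio (isPreconnected_Iio (a := b))
    (fun n y _ => hterm n y) (fun n y hy => ?_) hwb hsum hwb
  · rwa [hlog.tsum_eq] at hder
  · have hn : (1 : ℝ) ≤ (n : ℝ) + 1 := by linarith [n.cast_nonneg (α := ℝ)]
    rw [norm_of_nonneg (by positivity)]
    refine (div_le_self (by positivity) hn).trans ?_
    gcongr
    exact le_of_lt hy

theorem hasDerivAt_h₀_fst (lam v w : ℝ) : HasDerivAt (fun r => h₀ lam r w) (-v / lam ^ 2) v := by
  refine ((((hasDerivAt_id v).pow 2).neg.div_const (2 * lam ^ 2)).add_const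
    (Li₂ (Real.exp w))).congr_deriv ?_
  simp only [id]
  push_cast
  ring

/-- The first of the recursion equations in integrated form: `∂h₁/∂v = h₀`. -/
theorem hasDerivAt_h₁_fst (lam v w : ℝ) : HasDerivAt (fun r => h₁ lam r w) (h₀ lam v w) v := by
  refine ((((hasDerivAt_id v).pow 3).neg.div_const (6 * lam ^ 2)).add
    ((hasDerivAt_id v).mul_const (Li₂ (Real.exp w)))).congr_deriv ?_
  simp only [id, h₀]
  push_cast
  ring

theorem hasDerivAt_h₁_snd (lam v : ℝ) {w : ℝ} (hw : w < 0) :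
    HasDerivAt (fun s => h₁ lam v s) (v * -Real.log (1 - Real.exp w)) w :=
  ((hasDerivAt_Li₂_exp hw).const_mul v).const_add _

theorem hasDerivAt_neg_log_one_sub_exp {w : ℝ} (hw : w < 0) :
    HasDerivAt (fun s => -Real.log (1 - Real.exp s)) (Real.exp w / (1 - Real.exp w)) w := by
  have h : 1 - Real.exp w ≠ 0 := (sub_pos.2 (Real.exp_lt_one_iff.2 hw)).ne'
  exact (((Real.hasDerivAt_exp w).const_sub 1).log h).neg.congr_deriv (by ring)

theorem conifold_deformed_flatness_recursion (lam : ℝ) (hlam : lam ≠ 0) :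
    ∀ (v : ℝ), ∀ w < (0 : ℝ),
      (deriv (fun s => deriv (fun r => h₁ lam r w) s) v = deriv (fun r => h₀ lam r w) v) ∧
      (deriv (fun s => deriv (fun r => h₁ lam r s) v) w = deriv (fun s => h₀ lam v s) w) ∧
      (deriv (fun s => deriv (fun r => h₁ lam v r) s) w =
        -lam ^ 2 * (Real.exp w / (1 - Real.exp w)) * deriv (fun r => h₀ lam r w) v) := by
  intro v w hw
  refine ⟨?_, ?_, ?_⟩
  · simp only [(hasDerivAt_h₁_fst lam _ _).deriv]
  · simp only [(hasDerivAt_h₁_fst lam _ _).deriv]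
  · have hsnd : (fun s => deriv (fun r => h₁ lam v r) s) =ᶠ[nhds w]
        fun s => v * -Real.log (1 - Real.exp s) := by
      filter_upwards [Iio_mem_nhds hw] with s hs using (hasDerivAt_h₁_snd lam v hs).deriv
    rw [hsnd.deriv_eq, ((hasDerivAt_neg_log_one_sub_exp hw).const_mul v).deriv,
      (hasDerivAt_h₀_fst lam v w).deriv]
    field_simp
end

section
/- Let λ ≠ 0 be real and let h_AL(v,w) := (e^w − 1) cosh(v/λ) denote the dispersionless Ablowitz–Ladik Hamiltonian density. Let f: ℝ × (−∞,0) → ℝ be C². Then the following are equivalent: (i) for every smooth loop (v,w): ℝ/ℤ → ℝ × (−∞,0), the hydrodynamic Poisson bracket of the local functionals vanishes, i.e. ∫₀¹ (−λ²) [ (∂f/∂v)(v(x),w(x)) · d/dx( (∂h_AL/∂w)(v(x),w(x)) ) + (∂f/∂w)(v(x),w(x)) · d/dx( (∂h_AL/∂v)(v(x),w(x)) ) ] dx = 0; (ii) f satisfies the linear wave equation ∂²f/∂w² + (λ² e^w/(1−e^w)) ∂²f/∂v² = 0 on ℝ × (−∞,0). -/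
/-- The dispersionless Ablowitz–Ladik Hamiltonian density `h_AL(v,w) = (e^w − 1) cosh(v/λ)`. -/
noncomputable def hAL (lam v w : ℝ) : ℝ := (Real.exp w - 1) * Real.cosh (v / lam)

/-- `∂h_AL/∂v`. -/
noncomputable def hALv (lam a b : ℝ) : ℝ := deriv (fun s => hAL lam s b) a

/-- `∂h_AL/∂w`. -/
noncomputable def hALw (lam a b : ℝ) : ℝ := deriv (fun r => hAL lam a r) b

open Set Filter Topology

section LoopIntegrals

variable {E : Type*} [NormedAddCommGroup E] [NormedSpace ℝ E]

/-- A closed 1-form on an open convex set integrates to zero along every `C¹` loop. -/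
theorem integral_loop_eq_zero_of_closed {s : Set E} (hs : Convex ℝ s) (hso : IsOpen s)
    {ω : E → E →L[ℝ] ℝ} {ω' : E → E →L[ℝ] E →L[ℝ] ℝ} (hω : ∀ p ∈ s, HasFDerivAt ω (ω' p) p)
    (hsymm : ∀ p ∈ s, ∀ y z, ω' p y z = ω' p z y)
    {γ : ℝ → E} (hγ : ContDiff ℝ 1 γ) (hγs : ∀ x, γ x ∈ s) (hloop : γ 0 = γ 1) :
    ∫ x in (0 : ℝ)..1, ω (γ x) (deriv γ x) = 0 := by
  obtain ⟨Φ, hΦ⟩ := hs.exists_forall_hasFDerivWithinAt_of_hasFDerivWithinAt_symmetric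
    (fun p hp => (hω p hp).hasFDerivWithinAt) (fun p hp y _ z _ => hsymm p hp y z)
  have hωγ : Continuous fun x => ω (γ x) := continuous_iff_continuousAt.2 fun x =>
    (hω _ (hγs x)).continuousAt.comp hγ.continuous.continuousAt
  rw [intervalIntegral.integral_eq_sub_of_hasDerivAt (f := fun x => Φ (γ x))
    (fun x _ => ((hΦ _ (hγs x)).hasFDerivAt (hso.mem_nhds (hγs x))).comp_hasDerivAt x
      (hγ.differentiable one_ne_zero x).hasDerivAt)
    ((hωγ.clm_apply (hγ.continuous_deriv le_rfl)).intervalIntegrable _ _)]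
  simp [hloop]

/-- The ellipse through `p + r • u` and `p + r • v`, centred at `p`. -/
noncomputable def ellipse (p u v : E) (r x : ℝ) : E :=
  p + r • (Real.cos (2 * Real.pi * x) • u + Real.sin (2 * Real.pi * x) • v)

/-- The velocity of the ellipse of unit size. -/
noncomputable def ellipseVel (u v : E) (x : ℝ) : E :=
  (2 * Real.pi) • (-Real.sin (2 * Real.pi * x) • u + Real.cos (2 * Real.pi * x) • v)

theorem hasDerivAt_ellipse (p u v : E) (r x : ℝ) :
    HasDerivAt (ellipse p u v r) (r • ellipseVel u v x) x := by
  have hlin : HasDerivAt (fun x : ℝ => 2 * Real.pi * x) (2 * Real.pi) x := by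
    simpa using (hasDerivAt_id x).const_mul (2 * Real.pi)
  convert! (((hlin.cos.smul_const u).add (hlin.sin.smul_const v)).const_smul r).const_add p using 1
  simp only [ellipseVel]
  module

theorem continuous_ellipseVel (u v : E) : Continuous (ellipseVel u v) := by
  unfold ellipseVel; fun_prop

theorem norm_ellipse_sub_le (p u v : E) (r x : ℝ) :
    ‖ellipse p u v r x - p‖ ≤ |r| * (‖u‖ + ‖v‖) := by
  simp only [ellipse, add_sub_cancel_left, norm_smul, Real.norm_eq_abs]
  gcongr
  refine (norm_add_le _ _).trans ?_
  simp only [norm_smul, Real.norm_eq_abs]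
  gcongr
  · exact mul_le_of_le_one_left (norm_nonneg _) (Real.abs_cos_le_one _)
  · exact mul_le_of_le_one_left (norm_nonneg _) (Real.abs_sin_le_one _)

theorem norm_ellipseVel_le (u v : E) (x : ℝ) :
    ‖ellipseVel u v x‖ ≤ 2 * Real.pi * (‖u‖ + ‖v‖) := by
  simp only [ellipseVel, norm_smul, Real.norm_eq_abs]
  rw [abs_of_pos Real.two_pi_pos]
  gcongr
  refine (norm_add_le _ _).trans ?_
  simp only [norm_smul, Real.norm_eq_abs, abs_neg]
  gcongr
  · exact mul_le_of_le_one_left (norm_nonneg _) (Real.abs_sin_le_one _)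
  · exact mul_le_of_le_one_left (norm_nonneg _) (Real.abs_cos_le_one _)

theorem integral_const_ellipseVel (u v : E) (L : E →L[ℝ] ℝ) :
    ∫ x in (0 : ℝ)..1, L (ellipseVel u v x) = 0 := by
  rw [intervalIntegral.integral_eq_sub_of_hasDerivAt (f := fun x => L (ellipse 0 u v 1 x))
    (f' := fun x => L (ellipseVel u v x))
    (fun x _ => by simpa using! L.hasFDerivAt.comp_hasDerivAt x (hasDerivAt_ellipse 0 u v 1 x))
    (Continuous.intervalIntegrable (L.continuous.comp (continuous_ellipseVel u v) :) _ _)]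
  simp [ellipse]

theorem integral_linear_ellipseVel (p u v : E) (r : ℝ) (B : E →L[ℝ] E →L[ℝ] ℝ) :
    ∫ x in (0 : ℝ)..1, B (ellipse p u v r x - p) (ellipseVel u v x)
      = r * (Real.pi * (B u v - B v u)) := by
  have hlin (x : ℝ) : HasDerivAt (fun x : ℝ => 2 * Real.pi * x) (2 * Real.pi) x := by
    simpa using (hasDerivAt_id x).const_mul (2 * Real.pi)
  rw [intervalIntegral.integral_eq_sub_of_hasDerivAt (f := fun x =>
      r * ((Real.pi * x) * (B u v - B v u)
      + (B u v + B v u) / 2 * (Real.sin (2 * Real.pi * x) * Real.cos (2 * Real.pi * x))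
      + (B v v - B u u) / 2 * Real.sin (2 * Real.pi * x) ^ 2))]
  · simp
  · intro x _
    have h1 := (((hasDerivAt_id x).const_mul Real.pi).mul_const (B u v - B v u))
    have h2 := ((hlin x).sin.mul (hlin x).cos).const_mul ((B u v + B v u) / 2)
    have h3 := ((hlin x).sin.pow 2).const_mul ((B v v - B u u) / 2)
    convert! ((h1.add h2).add h3).const_mul r using 1
    simp [ellipse, ellipseVel]
    linear_combination (r * Real.pi * (B u v - B v u)) *
      Real.sin_sq_add_cos_sq (2 * Real.pi * x)
  · refine Continuous.intervalIntegrable ?_ _ _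
    unfold ellipse ellipseVel
    fun_prop

/-- If a 1-form integrates to zero along all small ellipses around `p`, it is closed at `p`. -/
theorem symm_of_integral_ellipse_eq_zero {s : Set E} (hso : IsOpen s) {ω : E → E →L[ℝ] ℝ}
    (hωc : ContinuousOn ω s) {p : E} (hp : p ∈ s) {B : E →L[ℝ] E →L[ℝ] ℝ}
    (hω : HasFDerivAt ω B p) (u v : E)
    (h : ∀ r > 0, (∀ x, ellipse p u v r x ∈ s) →
      ∫ x in (0 : ℝ)..1, ω (ellipse p u v r x) (r • ellipseVel u v x) = 0) :
    B u v = B v u := by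
  set M := ‖u‖ + ‖v‖
  have hM0 : 0 ≤ M := by positivity
  have key : ∀ c > 0, |Real.pi * (B u v - B v u)| ≤ c * (M * (2 * Real.pi * M)) := by
    intro c hc
    have hev := ((hasFDerivAt_iff_isLittleO.1 hω).def hc).and (hso.mem_nhds hp)
    obtain ⟨δ, hδ, hball⟩ := Metric.eventually_nhds_iff.1 hev
    obtain ⟨r, hr, hrδ⟩ : ∃ r > 0, r * M < δ := by
      refine ⟨δ / (M + 1), by positivity, ?_⟩
      rw [div_mul_eq_mul_div, div_lt_iff₀ (by positivity)]
      nlinarith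
    have hdist (x : ℝ) : ‖ellipse p u v r x - p‖ ≤ r * M := by
      simpa [abs_of_pos hr] using norm_ellipse_sub_le p u v r x
    have hx (x : ℝ) := hball (y := ellipse p u v r x)
      (by rw [dist_eq_norm]; exact (hdist x).trans_lt hrδ)
    have hcont : Continuous (ellipse p u v r) :=
      continuous_iff_continuousAt.2 fun x => (hasDerivAt_ellipse p u v r x).continuousAt
    have hvel := continuous_ellipseVel u v
    have hωvel : Continuous fun x => ω (ellipse p u v r x) (ellipseVel u v x) :=
      (hωc.comp_continuous hcont fun x => (hx x).2).clm_apply hvel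
    have h0 : ∫ x in (0 : ℝ)..1, ω (ellipse p u v r x) (ellipseVel u v x) = 0 := by
      have := h r hr fun x => (hx x).2
      simpa [hr.ne'] using this
    have herr : ∫ x in (0 : ℝ)..1, (ω (ellipse p u v r x) - ω p - B (ellipse p u v r x - p))
        (ellipseVel u v x) = -(r * (Real.pi * (B u v - B v u))) := by
      simp only [sub_apply]
      rw [intervalIntegral.integral_sub, intervalIntegral.integral_sub, h0,
        integral_const_ellipseVel, integral_linear_ellipseVel]
      · ring
      · exact hωvel.intervalIntegrable _ _
      · exact Continuous.intervalIntegrable (by fun_prop) _ _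
      · exact (hωvel.sub (by fun_prop)).intervalIntegrable _ _
      · exact Continuous.intervalIntegrable (by fun_prop) _ _
    have hbound := intervalIntegral.norm_integral_le_of_norm_le_const (a := 0) (b := 1)
      (C := c * (r * M) * (2 * Real.pi * M)) (f := fun x =>
        (ω (ellipse p u v r x) - ω p - B (ellipse p u v r x - p)) (ellipseVel u v x))
      (fun x _ => (ContinuousLinearMap.le_opNorm _ _).trans
        (mul_le_mul ((hx x).1.trans (by gcongr; exact hdist x)) (norm_ellipseVel_le u v x)
          (norm_nonneg _) (by positivity)))
    rw [herr, norm_neg, norm_mul, Real.norm_of_nonneg hr.le, Real.norm_eq_abs] at hbound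
    refine le_of_mul_le_mul_left (hbound.trans (le_of_eq ?_)) hr
    simp
    ring
  have hzero : |Real.pi * (B u v - B v u)| ≤ 0 := by
    refine le_of_forall_pos_le_add fun ε hε => ?_
    have hK : 0 ≤ M * (2 * Real.pi * M) := by positivity
    refine (key (ε / (M * (2 * Real.pi * M) + 1)) (by positivity)).trans ?_
    rw [zero_add, div_mul_eq_mul_div, div_le_iff₀ (by positivity)]
    nlinarith
  have := abs_nonpos_iff.1 hzero
  linarith [(mul_eq_zero.1 this).resolve_left Real.pi_ne_zero]

end LoopIntegrals

section AblowitzLadik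

variable {lam : ℝ}

theorem hALv_eq (a b : ℝ) :
    hALv lam a b = (Real.exp b - 1) * (Real.sinh (a / lam) / lam) := by
  simp [hALv, hAL, div_eq_mul_inv]

theorem hALw_eq (a b : ℝ) : hALw lam a b = Real.exp b * Real.cosh (a / lam) := by
  simp [hALw, hAL]

theorem contDiff_hALv : ContDiff ℝ 2 fun p : ℝ × ℝ => hALv lam p.1 p.2 := by
  simp only [hALv_eq, div_eq_mul_inv]
  fun_prop

theorem contDiff_hALw : ContDiff ℝ 2 fun p : ℝ × ℝ => hALw lam p.1 p.2 := by
  simp only [hALw_eq, div_eq_mul_inv]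
  fun_prop

theorem fderiv_apply_fst {g : ℝ × ℝ → ℝ} {p : ℝ × ℝ} (hg : DifferentiableAt ℝ g p) :
    deriv (fun s => g (s, p.2)) p.1 = fderiv ℝ g p (1, 0) :=
  (hg.hasFDerivAt.comp_hasDerivAt (f := fun s => (s, p.2)) p.1
    ((hasDerivAt_id p.1).prodMk (hasDerivAt_const p.1 p.2))).deriv

theorem fderiv_apply_snd {g : ℝ × ℝ → ℝ} {p : ℝ × ℝ} (hg : DifferentiableAt ℝ g p) :
    deriv (fun s => g (p.1, s)) p.2 = fderiv ℝ g p (0, 1) :=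
  (hg.hasFDerivAt.comp_hasDerivAt (f := fun s => (p.1, s)) p.2
    ((hasDerivAt_const p.2 p.1).prodMk (hasDerivAt_id p.2))).deriv

theorem fderiv_hALv_fst (p : ℝ × ℝ) :
    fderiv ℝ (fun p : ℝ × ℝ => hALv lam p.1 p.2) p (1, 0)
      = (Real.exp p.2 - 1) * Real.cosh (p.1 / lam) / lam ^ 2 := by
  rw [← fderiv_apply_fst (contDiff_hALv.differentiable two_ne_zero p)]
  simp only [hALv_eq]
  have := ((((hasDerivAt_id p.1).div_const lam).sinh).div_const lam).const_mul (Real.exp p.2 - 1)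
  refine this.deriv.trans ?_
  simp only [id]
  ring

theorem fderiv_hALw_snd (p : ℝ × ℝ) :
    fderiv ℝ (fun p : ℝ × ℝ => hALw lam p.1 p.2) p (0, 1)
      = Real.exp p.2 * Real.cosh (p.1 / lam) := by
  rw [← fderiv_apply_snd (contDiff_hALw.differentiable two_ne_zero p)]
  simp only [hALw_eq]
  exact ((Real.hasDerivAt_exp p.2).mul_const _).deriv

theorem fderiv_hALv_snd (p : ℝ × ℝ) :
    fderiv ℝ (fun p : ℝ × ℝ => hALv lam p.1 p.2) p (0, 1)
      = fderiv ℝ (fun p : ℝ × ℝ => hALw lam p.1 p.2) p (1, 0) := by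
  rw [← fderiv_apply_snd (contDiff_hALv.differentiable two_ne_zero p),
    ← fderiv_apply_fst (contDiff_hALw.differentiable two_ne_zero p)]
  simp only [hALv_eq, hALw_eq]
  refine (((Real.hasDerivAt_exp p.2).sub_const 1).mul_const _).deriv.trans ?_
  refine Eq.symm (((((hasDerivAt_id p.1).div_const lam).cosh).const_mul _).deriv.trans ?_)
  simp only [id]
  ring

/-- The 1-form `f_v d(h_w) + f_w d(h_v)`, whose pullback along a loop is, up to the factor `-λ²`,
the integrand of the hydrodynamic bracket of `F` with the Ablowitz–Ladik Hamiltonian. -/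
noncomputable def bracketForm (lam : ℝ) (F : ℝ × ℝ → ℝ) (p : ℝ × ℝ) : ℝ × ℝ →L[ℝ] ℝ :=
  fderiv ℝ F p (1, 0) • fderiv ℝ (fun p : ℝ × ℝ => hALw lam p.1 p.2) p
    + fderiv ℝ F p (0, 1) • fderiv ℝ (fun p : ℝ × ℝ => hALv lam p.1 p.2) p

theorem bracketForm_apply_deriv {F : ℝ × ℝ → ℝ} {v w : ℝ → ℝ} {x : ℝ}
    (hv : DifferentiableAt ℝ v x) (hw : DifferentiableAt ℝ w x)
    (hF : DifferentiableAt ℝ F (v x, w x)) :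
    deriv (fun s => F (s, w x)) (v x) * deriv (fun s => hALw lam (v s) (w s)) x
        + deriv (fun s => F (v x, s)) (w x) * deriv (fun s => hALv lam (v s) (w s)) x
      = bracketForm lam F (v x, w x) (deriv v x, deriv w x) := by
  have hγ := hv.hasDerivAt.prodMk hw.hasDerivAt
  have hV := ((contDiff_hALv (lam := lam)).differentiable two_ne_zero
    (v x, w x)).hasFDerivAt.comp_hasDerivAt x hγ
  have hW := ((contDiff_hALw (lam := lam)).differentiable two_ne_zero
    (v x, w x)).hasFDerivAt.comp_hasDerivAt x hγ
  have h1 := fderiv_apply_fst hF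
  have h2 := fderiv_apply_snd hF
  simp only at h1 h2
  rw [h1, h2, show deriv (fun s => hALw lam (v s) (w s)) x = _ from hW.deriv,
    show deriv (fun s => hALv lam (v s) (w s)) x = _ from hV.deriv]
  simp [bracketForm]

theorem exists_hasFDerivAt_bracketForm {F : ℝ × ℝ → ℝ} {p : ℝ × ℝ} (hF : ContDiffAt ℝ 2 F p) :
    ∃ B : ℝ × ℝ →L[ℝ] ℝ × ℝ →L[ℝ] ℝ, HasFDerivAt (bracketForm lam F) B p ∧
      B (0, 1) (1, 0) - B (1, 0) (0, 1)
        = (fderiv ℝ (fderiv ℝ F) p (0, 1) (0, 1) * ((Real.exp p.2 - 1) / lam ^ 2)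
          - fderiv ℝ (fderiv ℝ F) p (1, 0) (1, 0) * Real.exp p.2) * Real.cosh (p.1 / lam) := by
  have hD {G : ℝ × ℝ → ℝ} (hG : ContDiffAt ℝ 2 G p) :
      HasFDerivAt (fderiv ℝ G) (fderiv ℝ (fderiv ℝ G) p) p :=
    ((hG.fderiv_right (m := 1) (by norm_num)).differentiableAt one_ne_zero).hasFDerivAt
  have hsymm {G : ℝ × ℝ → ℝ} (hG : ContDiffAt ℝ 2 G p) :
      fderiv ℝ (fderiv ℝ G) p (0, 1) (1, 0) = fderiv ℝ (fderiv ℝ G) p (1, 0) (0, 1) :=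
    hG.isSymmSndFDerivAt (by simp) _ _
  have happ (z : ℝ × ℝ) := (hD hF).clm_apply (hasFDerivAt_const z p)
  have hV := (contDiff_hALv (lam := lam)).contDiffAt (x := p)
  have hW := (contDiff_hALw (lam := lam)).contDiffAt (x := p)
  refine ⟨_, ((happ (1, 0)).smul (hD hW)).add ((happ (0, 1)).smul (hD hV)), ?_⟩
  simp [fderiv_hALv_fst, fderiv_hALw_snd, fderiv_hALv_snd, hsymm hF, hsymm hV, hsymm hW]
  ring

theorem apply_comm_of_apply_basis_comm {B : ℝ × ℝ →L[ℝ] ℝ × ℝ →L[ℝ] ℝ}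
    (h : B (0, 1) (1, 0) = B (1, 0) (0, 1)) (y z : ℝ × ℝ) : B y z = B z y := by
  have hdec (y : ℝ × ℝ) : y = y.1 • ((1, 0) : ℝ × ℝ) + y.2 • ((0, 1) : ℝ × ℝ) := by
    ext <;> simp
  rw [hdec y, hdec z]
  simp only [map_add, map_smul, add_apply, smul_apply, smul_eq_mul, h]
  ring

theorem deriv_deriv_fst {F : ℝ × ℝ → ℝ} {p : ℝ × ℝ} (hF : ContDiffAt ℝ 2 F p) :
    deriv (fun s => deriv (fun r => F (r, p.2)) s) p.1
      = fderiv ℝ (fderiv ℝ F) p (1, 0) (1, 0) := by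
  have hD := ((hF.fderiv_right (m := 1) (by norm_num)).differentiableAt one_ne_zero).hasFDerivAt
  have hline : HasDerivAt (fun s : ℝ => (s, p.2)) (1, 0) p.1 :=
    (hasDerivAt_id p.1).prodMk (hasDerivAt_const p.1 p.2)
  have hev : ∀ᶠ s in 𝓝 p.1, deriv (fun r => F (r, p.2)) s = fderiv ℝ F (s, p.2) (1, 0) :=
    (hline.continuousAt.eventually (hF.eventually (by simp))).mono fun s hs =>
      fderiv_apply_fst (p := (s, p.2)) (hs.differentiableAt two_ne_zero)
  have hG : HasFDerivAt (fun q => fderiv ℝ F q (1, 0)) _ p := hD.clm_apply (hasFDerivAt_const _ p)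
  refine (Filter.EventuallyEq.deriv_eq hev).trans ((fderiv_apply_fst hG.differentiableAt).trans ?_)
  rw [hG.fderiv]
  simp

theorem deriv_deriv_snd {F : ℝ × ℝ → ℝ} {p : ℝ × ℝ} (hF : ContDiffAt ℝ 2 F p) :
    deriv (fun s => deriv (fun r => F (p.1, r)) s) p.2
      = fderiv ℝ (fderiv ℝ F) p (0, 1) (0, 1) := by
  have hD := ((hF.fderiv_right (m := 1) (by norm_num)).differentiableAt one_ne_zero).hasFDerivAt
  have hline : HasDerivAt (fun s : ℝ => (p.1, s)) (0, 1) p.2 :=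
    (hasDerivAt_const p.2 p.1).prodMk (hasDerivAt_id p.2)
  have hev : ∀ᶠ s in 𝓝 p.2, deriv (fun r => F (p.1, r)) s = fderiv ℝ F (p.1, s) (0, 1) :=
    (hline.continuousAt.eventually (hF.eventually (by simp))).mono fun s hs =>
      fderiv_apply_snd (p := (p.1, s)) (hs.differentiableAt two_ne_zero)
  have hG : HasFDerivAt (fun q => fderiv ℝ F q (0, 1)) _ p := hD.clm_apply (hasFDerivAt_const _ p)
  refine (Filter.EventuallyEq.deriv_eq hev).trans ((fderiv_apply_snd hG.differentiableAt).trans ?_)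
  rw [hG.fderiv]
  simp

theorem wave_iff_closed (hlam : lam ≠ 0) {a b w c : ℝ} (hw : w < 0) (hc : 0 < c) :
    a + lam ^ 2 * Real.exp w / (1 - Real.exp w) * b = 0
      ↔ (a * ((Real.exp w - 1) / lam ^ 2) - b * Real.exp w) * c = 0 := by
  have h1 : 1 - Real.exp w ≠ 0 := (sub_pos.2 (by simpa using hw)).ne'
  have : (a * ((Real.exp w - 1) / lam ^ 2) - b * Real.exp w) * c
      = -(c * (1 - Real.exp w) / lam ^ 2) *
        (a + lam ^ 2 * Real.exp w / (1 - Real.exp w) * b) := by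
    field_simp
    ring
  rw [this]
  simp [hc.ne', h1, hlam]

end AblowitzLadik

theorem AL_involution_iff_linear_wave (lam : ℝ) (hlam : lam ≠ 0) (f : ℝ → ℝ → ℝ)
    (hf : ContDiffOn ℝ 2 (fun p : ℝ × ℝ => f p.1 p.2) (Set.univ ×ˢ Set.Iio 0)) :
    (∀ v w : ℝ → ℝ, ContDiff ℝ (⊤ : ℕ∞) v → ContDiff ℝ (⊤ : ℕ∞) w →
      Function.Periodic v 1 → Function.Periodic w 1 → (∀ x : ℝ, w x < 0) →
      ∫ x in (0:ℝ)..1, (-lam ^ 2) *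
        (deriv (fun s => f s (w x)) (v x) * deriv (fun s => hALw lam (v s) (w s)) x
          + deriv (fun s => f (v x) s) (w x) * deriv (fun s => hALv lam (v s) (w s)) x)
        = 0)
    ↔ (∀ (v : ℝ), ∀ w < (0 : ℝ),
        deriv (fun s => deriv (fun r => f v r) s) w
          + lam ^ 2 * Real.exp w / (1 - Real.exp w) *
            deriv (fun s => deriv (fun r => f r w) s) v = 0) := by
  have hso : IsOpen ((univ : Set ℝ) ×ˢ Iio (0 : ℝ)) := isOpen_univ.prod isOpen_Iio
  set F : ℝ × ℝ → ℝ := fun p => f p.1 p.2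
  have hF (p) (hp : p ∈ (univ : Set ℝ) ×ˢ Iio (0 : ℝ)) : ContDiffAt ℝ 2 F p :=
    hf.contDiffAt (hso.mem_nhds hp)
  have hbracket {v w : ℝ → ℝ} (hv : Differentiable ℝ v) (hw : Differentiable ℝ w)
      (hneg : ∀ x, w x < 0) :
      ∫ x in (0:ℝ)..1, (-lam ^ 2) *
        (deriv (fun s => f s (w x)) (v x) * deriv (fun s => hALw lam (v s) (w s)) x
          + deriv (fun s => f (v x) s) (w x) * deriv (fun s => hALv lam (v s) (w s)) x)
      = (-lam ^ 2) *
        ∫ x in (0:ℝ)..1, bracketForm lam F (v x, w x) (deriv (fun x => (v x, w x)) x) := by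
    rw [← intervalIntegral.integral_const_mul]
    refine intervalIntegral.integral_congr fun x _ => ?_
    rw [((hv x).hasDerivAt.prodMk (hw x).hasDerivAt).deriv, ← bracketForm_apply_deriv (hv x) (hw x)
      ((hF (v x, w x) ⟨mem_univ _, hneg x⟩).differentiableAt two_ne_zero)]
  choose! B hB hBeq using fun p hp => exists_hasFDerivAt_bracketForm (lam := lam) (hF p hp)
  have hclosed (v w : ℝ) (hw : w < 0) :
      deriv (fun s => deriv (fun r => f v r) s) w
          + lam ^ 2 * Real.exp w / (1 - Real.exp w) *
            deriv (fun s => deriv (fun r => f r w) s) v = 0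
      ↔ B (v, w) (0, 1) (1, 0) = B (v, w) (1, 0) (0, 1) := by
    have hp : (v, w) ∈ (univ : Set ℝ) ×ˢ Iio (0 : ℝ) := ⟨mem_univ _, hw⟩
    rw [← sub_eq_zero (a := B (v, w) (0, 1) (1, 0)), hBeq _ hp,
      ← wave_iff_closed hlam hw (Real.cosh_pos _), ← deriv_deriv_fst (hF _ hp),
      ← deriv_deriv_snd (hF _ hp)]
  constructor
  · intro h v w hw
    rw [hclosed v w hw]
    have hp : (v, w) ∈ (univ : Set ℝ) ×ˢ Iio (0 : ℝ) := ⟨mem_univ _, hw⟩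
    refine symm_of_integral_ellipse_eq_zero hso
      (fun p hp => (hB p hp).continuousAt.continuousWithinAt) hp (hB _ hp) _ _ fun r _ hr => ?_
    have hsmooth : ContDiff ℝ (⊤ : ℕ∞) (ellipse (v, w) (0, 1) (1, 0) r) := by
      unfold ellipse; fun_prop
    have hper : Function.Periodic (ellipse (v, w) (0, 1) (1, 0) r) 1 := fun x => by
      simp [ellipse, mul_add]
    have hv := contDiff_fst.comp hsmooth
    have hw := contDiff_snd.comp hsmooth
    have := h _ _ hv hw (hper.comp Prod.fst) (hper.comp Prod.snd) fun x => (hr x).2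
    rw [hbracket (hv.differentiable (by simp)) (hw.differentiable (by simp)) fun x => (hr x).2] at this
    simpa [hlam, (hasDerivAt_ellipse _ _ _ _ _).deriv] using this
  · intro h v w hv hw hvper hwper hneg
    rw [hbracket (hv.differentiable (by simp)) (hw.differentiable (by simp)) hneg,
      integral_loop_eq_zero_of_closed (convex_univ.prod (convex_Iio 0)) hso hB
        (fun p hp => apply_comm_of_apply_basis_comm ((hclosed p.1 p.2 hp.2).1 (h _ _ hp.2)))
        ((hv.prodMk hw).of_le (by exact_mod_cast le_top)) (fun x => ⟨mem_univ _, hneg x⟩)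
        (by rw [← hvper 0, ← hwper 0, zero_add]), mul_zero]
end

section
/- Let n, k ≥ 1 and let h: (ℝⁿ)^{k+1} → ℝ be smooth. For a smooth 1-periodic map u: ℝ → ℝⁿ and index α ∈ {1,…,n}, define the Euler–Lagrange expression E_α[u](x) := ∑_{j=0}^{k} (−1)^j (d/dx)^j [ (∂h/∂ξ^α_j)(u(x), u′(x), …, u^{(k)}(x)) ], where ξ^α_j denotes the variable slot of h corresponding to the j-th derivative of the α-th component. Then E_α[u] ≡ 0 for every smooth 1-periodic u and every α if and only if there exist a constant c ∈ ℝ and a smooth function g: (ℝⁿ)^k → ℝ such that for every smooth u: ℝ → ℝⁿ and every x, h(u(x), u′(x), …, u^{(k)}(x)) = c + (d/dx)[ g(u(x), u′(x), …, u^{(k−1)}(x)) ]. -/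
open scoped ContDiff

theorem Differentiable.hasFDerivAt_prodMk_left {E F : Type*} [NormedAddCommGroup E]
    [NormedSpace ℝ E] [NormedAddCommGroup F] [NormedSpace ℝ F] {f : E × ℝ → F}
    (hf : Differentiable ℝ f) (x : E) (t : ℝ) :
    HasFDerivAt (fun y => f (y, t))
      ((fderiv ℝ f (x, t)).comp (ContinuousLinearMap.inl ℝ E ℝ)) x :=
  (hf (x, t)).hasFDerivAt.comp x (_root_.hasFDerivAt_prodMk_left x t)

/-- Differentiation under the integral sign over `[a, b]` for a jointly `C¹` integrand. -/
theorem hasFDerivAt_intervalIntegral_of_contDiff {E F : Type*} [NormedAddCommGroup E]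
    [NormedSpace ℝ E] [FiniteDimensional ℝ E] [NormedAddCommGroup F] [NormedSpace ℝ F]
    {f : E × ℝ → F} (hf : ContDiff ℝ 1 f) (a b : ℝ) (x : E) :
    HasFDerivAt (fun y => ∫ t in a..b, f (y, t))
      (∫ t in a..b, (fderiv ℝ f (x, t)).comp (ContinuousLinearMap.inl ℝ E ℝ)) x := by
  have : ProperSpace E := FiniteDimensional.proper ℝ E
  have hcont : Continuous fun p : E × ℝ =>
      (fderiv ℝ f p).comp (ContinuousLinearMap.inl ℝ E ℝ) :=
    (hf.continuous_fderiv one_ne_zero).clm_comp continuous_const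
  obtain ⟨C, hC⟩ := ((isCompact_closedBall x 1).prod
    (isCompact_uIcc (a := a) (b := b))).exists_bound_of_continuousOn hcont.continuousOn
  refine intervalIntegral.hasFDerivAt_integral_of_dominated_of_fderiv_le
    (bound := fun _ => C)
    (F' := fun y t => (fderiv ℝ f (y, t)).comp (ContinuousLinearMap.inl ℝ E ℝ))
    (Metric.closedBall_mem_nhds x one_pos) ?_ ?_ ?_ ?_ ?_ ?_
  · exact .of_forall fun y =>
      (hf.continuous.comp (by fun_prop : Continuous fun t : ℝ => (y, t))).aestronglyMeasurable
  · exact (hf.continuous.comp (by fun_prop : Continuous fun t : ℝ => (x, t))).intervalIntegrable _ _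
  · exact (hcont.comp (by fun_prop : Continuous fun t : ℝ => (x, t))).aestronglyMeasurable
  · exact .of_forall fun t ht y hy => hC (y, t) ⟨hy, Set.uIoc_subset_uIcc ht⟩
  · exact intervalIntegrable_const
  · exact .of_forall fun t _ y _ => (hf.differentiable one_ne_zero).hasFDerivAt_prodMk_left y t

/-- The integral over `[a, b]` of a jointly smooth integrand is smooth in the parameter. -/
theorem contDiff_intervalIntegral_of_contDiff {E F : Type*} [NormedAddCommGroup E]
    [NormedSpace ℝ E] [FiniteDimensional ℝ E] [NormedAddCommGroup F] [NormedSpace ℝ F]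
    {f : E × ℝ → F} (hf : ContDiff ℝ ∞ f) (a b : ℝ) :
    ContDiff ℝ ∞ (fun x => ∫ t in a..b, f (x, t)) := by
  refine contDiff_infty.2 fun n => ?_
  induction n generalizing f with
  | zero =>
    exact contDiff_zero.2
      (intervalIntegral.continuous_parametric_intervalIntegral_of_continuous'
        (f := fun x t => f (x, t)) hf.continuous a b)
  | succ n ih =>
    have hd : ∀ x, HasFDerivAt (fun y => ∫ t in a..b, f (y, t)) _ x :=
      hasFDerivAt_intervalIntegral_of_contDiff (hf.of_le (by simp)) a b
    push_cast
    refine (contDiff_succ_iff_fderiv_apply (n := n)).2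
      ⟨fun x => (hd x).differentiableAt, by simp, fun v => ?_⟩
    have hv : ContDiff ℝ ∞ fun p => fderiv ℝ f p (v, 0) :=
      (hf.fderiv_right (m := ∞) (by simp)).clm_apply contDiff_const
    convert ih hv using 2 with x
    rw [(hd x).fderiv, ContinuousLinearMap.intervalIntegral_apply]
    · rfl
    · have hcont : Continuous fun p : E × ℝ =>
          (fderiv ℝ f p).comp (ContinuousLinearMap.inl ℝ E ℝ) :=
        (hf.continuous_fderiv (by simp)).clm_comp continuous_const
      exact (hcont.comp (by fun_prop : Continuous fun t : ℝ => (x, t))).intervalIntegrable _ _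

/-- The `i`-th entry of a finite sequence, read as `0` past its end. -/
noncomputable def entryCLM (W : Type*) [NormedAddCommGroup W] [NormedSpace ℝ W] (a i : ℕ) :
    (Fin a → W) →L[ℝ] W :=
  if h : i < a then ContinuousLinearMap.proj ⟨i, h⟩ else 0

/-- Truncate a finite sequence, or extend it by zero, to length `b`. -/
noncomputable def resizeCLM (W : Type*) [NormedAddCommGroup W] [NormedSpace ℝ W] (a b : ℕ) :
    (Fin a → W) →L[ℝ] (Fin b → W) :=
  ContinuousLinearMap.pi fun i => entryCLM W a i

/-- Drop the first entry of a finite sequence, then truncate or extend by zero to length `b`. -/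
noncomputable def shiftCLM (W : Type*) [NormedAddCommGroup W] [NormedSpace ℝ W] (a b : ℕ) :
    (Fin a → W) →L[ℝ] (Fin b → W) :=
  ContinuousLinearMap.pi fun i => entryCLM W a (i + 1)

/-- The first `m` derivatives, starting from order `0`, of a curve `u` at `x`. -/
noncomputable def jet {W : Type*} [NormedAddCommGroup W] [NormedSpace ℝ W] (m : ℕ) (u : ℝ → W)
    (x : ℝ) : Fin m → W :=
  fun i => iteratedDeriv i u x

section Jet

variable {W : Type*} [NormedAddCommGroup W] [NormedSpace ℝ W]

theorem entryCLM_of_lt {a i : ℕ} (hi : i < a) (ξ : Fin a → W) :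
    entryCLM W a i ξ = ξ ⟨i, hi⟩ := by
  simp [entryCLM, hi]

theorem entryCLM_of_le {a i : ℕ} (hi : a ≤ i) (ξ : Fin a → W) : entryCLM W a i ξ = 0 := by
  simp [entryCLM, hi.not_gt]

@[simp]
theorem resizeCLM_apply (a b : ℕ) (ξ : Fin a → W) (i : Fin b) :
    resizeCLM W a b ξ i = entryCLM W a i ξ := rfl

@[simp]
theorem shiftCLM_apply (a b : ℕ) (ξ : Fin a → W) (i : Fin b) :
    shiftCLM W a b ξ i = entryCLM W a (i + 1) ξ := rfl

theorem entryCLM_jet {m i : ℕ} (hi : i < m) (u : ℝ → W) (x : ℝ) :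
    entryCLM W m i (jet m u x) = iteratedDeriv i u x := by
  rw [entryCLM_of_lt hi, jet]

theorem resizeCLM_jet {a b : ℕ} (hab : b ≤ a) (u : ℝ → W) (x : ℝ) :
    resizeCLM W a b (jet a u x) = jet b u x := by
  ext1 i
  rw [resizeCLM_apply, entryCLM_jet (i.2.trans_le hab), jet]

theorem contDiff_jet {u : ℝ → W} (hu : ContDiff ℝ ∞ u) (m : ℕ) : ContDiff ℝ ∞ (jet m u) :=
  contDiff_pi' fun i => by
    simpa only [jet, iteratedDeriv_eq_iterate] using hu.iterate_deriv i

theorem hasDerivAt_jet {u : ℝ → W} (hu : ContDiff ℝ ∞ u) (m : ℕ) (x : ℝ) :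
    HasDerivAt (jet m u) (shiftCLM W (m + 1) m (jet (m + 1) u x)) x := by
  refine hasDerivAt_pi.2 fun i => ?_
  rw [shiftCLM_apply, entryCLM_jet (by omega), iteratedDeriv_succ]
  exact ((hu.differentiable_iteratedDeriv i (mod_cast ENat.natCast_lt_top _)) x).hasDerivAt

/-- Every finite sequence moves along the flow of the shift as the jet of a smooth curve. -/
theorem exists_contDiff_hasDerivAt_shift (m : ℕ) (ξ : Fin m → W) [CompleteSpace W] :
    ∃ γ : ℝ → (Fin m → W), γ 0 = ξ ∧ ContDiff ℝ ∞ γ ∧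
      ∀ x, HasDerivAt γ (shiftCLM W m m (γ x)) x := by
  have hd : ∀ x : ℝ, HasDerivAt (fun y : ℝ => NormedSpace.exp (y • shiftCLM W m m) ξ)
      (shiftCLM W m m (NormedSpace.exp (x • shiftCLM W m m) ξ)) x := fun x => by
    simpa using (hasDerivAt_exp_smul_const' (𝕂 := ℝ) (shiftCLM W m m) x).clm_apply
      (hasDerivAt_const x ξ)
  refine ⟨_, by simp, contDiff_infty.2 fun n => ?_, hd⟩
  induction n with
  | zero => exact contDiff_zero.2 (continuous_iff_continuousAt.2 fun x => (hd x).continuousAt)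
  | succ n ih =>
    push_cast
    refine contDiff_succ_iff_deriv.2 ⟨fun x => (hd x).differentiableAt, by simp, ?_⟩
    rw [funext fun x => (hd x).deriv]
    exact (shiftCLM W m m).contDiff.comp ih

theorem iteratedDeriv_eq_of_hasDerivAt_shift {m : ℕ} {γ : ℝ → (Fin m → W)}
    (hγ : ∀ x, HasDerivAt γ (shiftCLM W m m (γ x)) x) (hm : 0 < m) (i : ℕ) (x : ℝ) :
    iteratedDeriv i (fun y => γ y ⟨0, hm⟩) x = entryCLM W m i (γ x) := by
  induction i generalizing x with
  | zero => simp [entryCLM_of_lt hm]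
  | succ i ih =>
    rw [iteratedDeriv_succ, funext ih]
    refine ((entryCLM W m i).hasFDerivAt.comp_hasDerivAt x (hγ x)).deriv.trans ?_
    rcases lt_or_ge i m with hi | hi
    · rw [entryCLM_of_lt hi, shiftCLM_apply]
    · rw [entryCLM_of_le hi, entryCLM_of_le (by omega)]

theorem jet_eq_of_hasDerivAt_shift {m : ℕ} {γ : ℝ → (Fin m → W)}
    (hγ : ∀ x, HasDerivAt γ (shiftCLM W m m (γ x)) x) (hm : 0 < m) (a : ℕ) (x : ℝ) :
    jet a (fun y => γ y ⟨0, hm⟩) x = resizeCLM W m a (γ x) := by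
  ext1 i
  exact iteratedDeriv_eq_of_hasDerivAt_shift hγ hm i x

theorem exists_contDiff_jet_eq [CompleteSpace W] {m : ℕ} (hm : 0 < m) (ξ : Fin m → W) :
    ∃ u : ℝ → W, ContDiff ℝ ∞ u ∧ jet m u 0 = ξ := by
  obtain ⟨γ, rfl, hγ, hd⟩ := exists_contDiff_hasDerivAt_shift m ξ
  refine ⟨fun y => γ y ⟨0, hm⟩, contDiff_pi.1 hγ _, ?_⟩
  rw [jet_eq_of_hasDerivAt_shift hd]
  ext1 i
  rw [resizeCLM_apply, entryCLM_of_lt i.2]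

/-- `f` is `c` plus the total derivative of `g`, as an identity between functions of jets. -/
def IsTotalDerivative {W : Type*} [NormedAddCommGroup W] [NormedSpace ℝ W] {k : ℕ}
    (h : (Fin (k + 1) → W) → ℝ) (c : ℝ) (g : (Fin k → W) → ℝ) : Prop :=
  ∀ ξ, h ξ = c + fderiv ℝ g (resizeCLM W (k + 1) k ξ) (shiftCLM W (k + 1) k ξ)


theorem forall_jet_eq_iff_isTotalDerivative [CompleteSpace W] {k : ℕ}
    {h : (Fin (k + 1) → W) → ℝ} {c : ℝ} {g : (Fin k → W) → ℝ} (hg : ContDiff ℝ ∞ g) :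
    (∀ u : ℝ → W, ContDiff ℝ ∞ u → ∀ x,
      h (jet (k + 1) u x) = c + deriv (fun y => g (jet k u y)) x) ↔ IsTotalDerivative h c g := by
  have hd : ∀ u : ℝ → W, ContDiff ℝ ∞ u → ∀ x, deriv (fun y => g (jet k u y)) x =
      fderiv ℝ g (resizeCLM W (k + 1) k (jet (k + 1) u x))
        (shiftCLM W (k + 1) k (jet (k + 1) u x)) := fun u hu x => by
    rw [resizeCLM_jet k.le_succ]
    exact ((hg.differentiable (by simp) _).hasFDerivAt.comp_hasDerivAt x
      (hasDerivAt_jet hu k x)).deriv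
  constructor
  · intro H ξ
    obtain ⟨u, hu, rfl⟩ := exists_contDiff_jet_eq k.succ_pos ξ
    rw [H u hu, hd u hu]
  · intro H u hu x
    rw [H, hd u hu]

theorem fderiv_of_isTotalDerivative {k : ℕ} {h : (Fin (k + 1) → W) → ℝ} {c : ℝ}
    {g : (Fin k → W) → ℝ} (hg : ContDiff ℝ ∞ g) (H : IsTotalDerivative h c g)
    (ξ η : Fin (k + 1) → W) :
    fderiv ℝ h ξ η =
      fderiv ℝ (fderiv ℝ g) (resizeCLM W (k + 1) k ξ) (shiftCLM W (k + 1) k ξ)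
          (resizeCLM W (k + 1) k η) +
        fderiv ℝ g (resizeCLM W (k + 1) k ξ) (shiftCLM W (k + 1) k η) := by
  have hg' : Differentiable ℝ (fderiv ℝ g) :=
    (hg.fderiv_right (m := ∞) (by simp)).differentiable (by simp)
  have hsymm : IsSymmSndFDerivAt ℝ g (resizeCLM W (k + 1) k ξ) :=
    hg.contDiffAt.isSymmSndFDerivAt (by simpa using WithTop.coe_le_coe.2 (le_top : (2 : ℕ∞) ≤ ⊤))
  have hd := (((hg' (resizeCLM W (k + 1) k ξ)).hasFDerivAt.comp ξ
    (resizeCLM W (k + 1) k).hasFDerivAt).clm_apply (shiftCLM W (k + 1) k).hasFDerivAt).const_add c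
  have hh : h = fun ξ => c + fderiv ℝ g (resizeCLM W (k + 1) k ξ) (shiftCLM W (k + 1) k ξ) :=
    funext H
  rw [hh]
  refine (congrArg (fun L => L η) hd.fderiv).trans ?_
  simp [hsymm.eq (shiftCLM W (k + 1) k ξ), add_comm]

/-- The Euler–Lagrange expression of a total derivative vanishes. -/
theorem eulerLagrange_eq_zero_of_isTotalDerivative {k : ℕ} {h : (Fin (k + 1) → W) → ℝ} {c : ℝ}
    {g : (Fin k → W) → ℝ} (hg : ContDiff ℝ ∞ g) (H : IsTotalDerivative h c g)
    {u : ℝ → W} (hu : ContDiff ℝ ∞ u) (v : W) (x : ℝ) :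
    ∑ j : Fin (k + 1), (-1 : ℝ) ^ (j : ℕ) *
      iteratedDeriv j (fun y => fderiv ℝ h (jet (k + 1) u y) (Pi.single j v)) x = 0 := by
  let e : ℕ → Fin k → W := fun i l => if (l : ℕ) = i then v else 0
  let b : ℕ → ℝ → ℝ := fun i y => fderiv ℝ g (jet k u y) (e i)
  have hg' : ContDiff ℝ ∞ (fderiv ℝ g) := hg.fderiv_right (by simp)
  have hb : ∀ i, ContDiff ℝ ∞ (b i) := fun i =>
    (hg'.comp (contDiff_jet hu k)).clm_apply contDiff_const
  have hdb : ∀ i y, deriv (b i) y = fderiv ℝ (fderiv ℝ g) (resizeCLM W (k + 1) k (jet (k + 1) u y))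
      (shiftCLM W (k + 1) k (jet (k + 1) u y)) (e i) := fun i y => by
    rw [resizeCLM_jet k.le_succ]
    have := ((hg'.differentiable (by simp) _).hasFDerivAt.comp_hasDerivAt y
      (hasDerivAt_jet hu k y)).clm_apply (hasDerivAt_const y (e i))
    simpa using this.deriv
  have hres : ∀ j : Fin (k + 1), resizeCLM W (k + 1) k (Pi.single j v) = e j := fun j => by
    ext1 l
    rw [resizeCLM_apply, entryCLM_of_lt (by omega), Pi.single_apply]
    simp [e, Fin.ext_iff]
  have hshift_zero : shiftCLM W (k + 1) k (Pi.single 0 v) = 0 := by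
    ext1 l
    rw [shiftCLM_apply, entryCLM_of_lt (by omega), Pi.single_apply]
    simp [Fin.ext_iff]
  have hshift_succ : ∀ j : Fin k, shiftCLM W (k + 1) k (Pi.single j.succ v) = e j := fun j => by
    ext1 l
    rw [shiftCLM_apply, entryCLM_of_lt (by omega), Pi.single_apply]
    simp [e, Fin.ext_iff]
  have hdb_smooth : ∀ i, ContDiff ℝ ∞ (deriv (b i)) := fun i =>
    (contDiff_infty_iff_deriv.1 (hb i)).2
  have hek : b k = 0 := by
    have : e k = 0 := by
      ext1 l
      simp [e, l.2.ne]
    ext y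
    simp [b, this]
  let s : ℕ → ℝ := fun i => (-1 : ℝ) ^ i * iteratedDeriv (i + 1) (b i) x
  have hterm : ∀ j : Fin k, (-1 : ℝ) ^ (j.succ : ℕ) *
      iteratedDeriv j.succ (fun y => fderiv ℝ h (jet (k + 1) u y) (Pi.single j.succ v)) x =
      s (j + 1) - s j := fun j => by
    simp only [fderiv_of_isTotalDerivative hg H, hres, hshift_succ, ← hdb]
    simp only [resizeCLM_jet k.le_succ]
    rw [iteratedDeriv_fun_add ((hdb_smooth _).of_le (mod_cast le_top)).contDiffAt
      (((hb j).of_le (mod_cast le_top)).contDiffAt (x := x))]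
    simp only [s, Fin.val_succ, iteratedDeriv_succ' (n := (j : ℕ) + 1), pow_succ]
    ring
  rw [Fin.sum_univ_succ, Finset.sum_congr rfl fun j _ => hterm j,
    Fin.sum_univ_eq_sum_range (fun i => s (i + 1) - s i), Finset.sum_range_sub]
  simp only [fderiv_of_isTotalDerivative hg H, hres, hshift_zero, ← hdb]
  simp [s, hek]

end Jet
open Filter Topology in
/-- A smooth `1`-periodic function that is the identity near `0`. -/
theorem exists_contDiff_periodic_eventuallyEq_id :
    ∃ φ : ℝ → ℝ, ContDiff ℝ ∞ φ ∧ Function.Periodic φ 1 ∧ φ =ᶠ[𝓝 0] id := by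
  let χ : ContDiffBump (0 : ℝ) := ⟨1 / 4, 1 / 2, by norm_num, by norm_num⟩
  have hψ : ContDiff ℝ ∞ fun s => χ s * Real.arcsin s := by
    refine contDiff_iff_contDiffAt.2 fun s => ?_
    by_cases hs : s ∈ tsupport χ
    · rw [χ.tsupport_eq, Metric.mem_closedBall, Real.dist_0_eq_abs] at hs
      have hs' : |s| ≤ 1 / 2 := hs
      rw [abs_le] at hs'
      exact χ.contDiffAt.mul (Real.contDiffAt_arcsin (by linarith) (by linarith))
    · refine (contDiffAt_const (c := (0 : ℝ))).congr_of_eventuallyEq ?_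
      filter_upwards [notMem_tsupport_iff_eventuallyEq.1 hs] with t ht
      simp [ht]
  refine ⟨fun y => (2 * Real.pi)⁻¹ * (χ (Real.sin (2 * Real.pi * y)) *
    Real.arcsin (Real.sin (2 * Real.pi * y))), ?_, fun y => ?_, ?_⟩
  · exact contDiff_const.mul
      (hψ.comp (Real.contDiff_sin.comp (contDiff_const.mul contDiff_id)))
  · simp only [mul_add, mul_one, Real.sin_add_two_pi]
  · have hc : Continuous fun y => Real.sin (2 * Real.pi * y) := by fun_prop
    have hl : Continuous fun y => 2 * Real.pi * y := by fun_prop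
    have h1 : ∀ᶠ y in 𝓝 (0 : ℝ), Real.sin (2 * Real.pi * y) ∈ Metric.closedBall (0 : ℝ) (1 / 4) :=
      hc.continuousAt.preimage_mem_nhds
        (by simpa using Metric.closedBall_mem_nhds (0 : ℝ) (by norm_num : (0 : ℝ) < 1 / 4))
    have h2 : ∀ᶠ y in 𝓝 (0 : ℝ), 2 * Real.pi * y ∈ Set.Icc (-(Real.pi / 2)) (Real.pi / 2) :=
      hl.continuousAt.preimage_mem_nhds (by
        have := Real.pi_pos
        simpa using Icc_mem_nhds (show -(Real.pi / 2) < 0 by linarith)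
          (show 0 < Real.pi / 2 by linarith))
    filter_upwards [h1, h2] with y hy1 hy2
    rw [χ.one_of_mem_closedBall hy1, Real.arcsin_sin hy2.1 hy2.2]
    have := Real.pi_pos.ne'
    simp only [id]
    field_simp

/-- The total derivative of a function on the space of jets with `m` entries, where the derivative
of the last entry is taken to be zero. -/
noncomputable def totalDeriv {W F : Type*} [NormedAddCommGroup W] [NormedSpace ℝ W]
    [NormedAddCommGroup F] [NormedSpace ℝ F] {m : ℕ} (f : (Fin m → W) → F) : (Fin m → W) → F :=
  fun ξ => fderiv ℝ f ξ (shiftCLM W m m ξ)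

section TotalDeriv

variable {W F F' : Type*} [NormedAddCommGroup W] [NormedSpace ℝ W] [NormedAddCommGroup F]
  [NormedSpace ℝ F] [NormedAddCommGroup F'] [NormedSpace ℝ F'] {m : ℕ}

theorem entryCLM_shiftCLM (i : ℕ) (ξ : Fin m → W) :
    entryCLM W m i (shiftCLM W m m ξ) = entryCLM W m (i + 1) ξ := by
  rcases lt_or_ge i m with hi | hi
  · rw [entryCLM_of_lt hi, shiftCLM_apply]
  · rw [entryCLM_of_le hi, entryCLM_of_le (by omega)]

theorem resizeCLM_resizeCLM_self {a b : ℕ} (hab : a ≤ b) (ξ : Fin a → W) :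
    resizeCLM W b a (resizeCLM W a b ξ) = ξ := by
  ext1 i
  rw [resizeCLM_apply, entryCLM_of_lt (by omega), resizeCLM_apply, entryCLM_of_lt i.2]

theorem contDiff_iterate_totalDeriv {f : (Fin m → W) → F} (hf : ContDiff ℝ ∞ f) (j : ℕ) :
    ContDiff ℝ ∞ (totalDeriv^[j] f) := by
  induction j with
  | zero => exact hf
  | succ j ih =>
    rw [Function.iterate_succ_apply']
    exact (ih.fderiv_right (by simp)).clm_apply (shiftCLM W m m).contDiff

theorem iterate_totalDeriv_clm_comp (L : F →L[ℝ] F') {f : (Fin m → W) → F}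
    (hf : ContDiff ℝ ∞ f) (j : ℕ) :
    totalDeriv^[j] (fun ξ => L (f ξ)) = fun ξ => L (totalDeriv^[j] f ξ) := by
  induction j with
  | zero => rfl
  | succ j ih =>
    ext ξ
    rw [Function.iterate_succ_apply', ih, Function.iterate_succ_apply', totalDeriv, totalDeriv]
    exact congrArg (fun T => T (shiftCLM W m m ξ))
      (L.hasFDerivAt.comp ξ
        ((contDiff_iterate_totalDeriv hf j).differentiable (by simp) ξ).hasFDerivAt).fderiv

theorem iteratedDeriv_comp_of_hasDerivAt_shift {f : (Fin m → W) → F} (hf : ContDiff ℝ ∞ f)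
    {γ : ℝ → (Fin m → W)} (hγ : ∀ x, HasDerivAt γ (shiftCLM W m m (γ x)) x) (j : ℕ) :
    iteratedDeriv j (fun y => f (γ y)) = fun x => totalDeriv^[j] f (γ x) := by
  induction j with
  | zero => simp
  | succ j ih =>
    ext x
    rw [iteratedDeriv_succ, ih, Function.iterate_succ_apply']
    have hj := (contDiff_iterate_totalDeriv hf j).differentiable (by simp)
    exact ((hj (γ x)).hasFDerivAt.comp_hasDerivAt x (hγ x)).deriv

theorem fderiv_eq_of_dependsOn {f : (Fin m → W) → F} {s : Set (Fin m)} (hf : DependsOn f s)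
    {x y : Fin m → W} (hxy : ∀ i ∈ s, x i = y i) : fderiv ℝ f x = fderiv ℝ f y := by
  have : (fun z => f (z + (y - x))) = f := funext fun z => hf fun i hi => by simp [hxy i hi]
  calc fderiv ℝ f x = fderiv ℝ (fun z => f (z + (y - x))) x := by rw [this]
    _ = fderiv ℝ f y := by rw [fderiv_comp_add_right, add_sub_cancel]

theorem fderiv_apply_eq_of_dependsOn {f : (Fin m → W) → F} {s : Set (Fin m)} (hf : DependsOn f s)
    (hd : Differentiable ℝ f) (x : Fin m → W) {v w : Fin m → W} (hvw : ∀ i ∈ s, v i = w i) :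
    fderiv ℝ f x v = fderiv ℝ f x w := by
  have key : ∀ v : Fin m → W, HasDerivAt (fun t : ℝ => f (x + t • v)) (fderiv ℝ f x v) 0 :=
    fun v => (hd x).hasFDerivAt.hasLineDerivAt v
  have : (fun t : ℝ => f (x + t • v)) = fun t => f (x + t • w) :=
    funext fun t => hf fun i hi => by simp [hvw i hi]
  exact (key v).unique (this ▸ key w)

theorem dependsOn_iterate_totalDeriv {f : (Fin m → W) → F} (hs : ContDiff ℝ ∞ f) {a : ℕ}
    (hf : DependsOn f {i | (i : ℕ) < a}) (j : ℕ) :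
    DependsOn (totalDeriv^[j] f) {i | (i : ℕ) < a + j} := by
  induction j with
  | zero => exact hf
  | succ j ih =>
    intro x y hxy
    rw [Function.iterate_succ_apply', totalDeriv, totalDeriv,
      fderiv_eq_of_dependsOn ih fun i hi =>
        hxy i (show (i : ℕ) < a + (j + 1) from hi.trans (by omega))]
    refine fderiv_apply_eq_of_dependsOn ih
      ((contDiff_iterate_totalDeriv hs j).differentiable (by simp)) y fun i hi => ?_
    rw [shiftCLM_apply, shiftCLM_apply]
    rcases lt_or_ge ((i : ℕ) + 1) m with him | him
    · rw [entryCLM_of_lt him, entryCLM_of_lt him]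
      exact hxy _ (Nat.add_lt_add_right hi 1)
    · rw [entryCLM_of_le him, entryCLM_of_le him]

theorem dependsOn_entryCLM {a i : ℕ} (hi : i < a) :
    DependsOn (entryCLM W m i) {i | (i : ℕ) < a} := by
  intro x y hxy
  rcases lt_or_ge i m with him | him
  · rw [entryCLM_of_lt him, entryCLM_of_lt him]
    exact hxy _ hi
  · rw [entryCLM_of_le him, entryCLM_of_le him]

theorem dependsOn_resizeCLM (a : ℕ) :
    DependsOn (resizeCLM W m a) {i | (i : ℕ) < a} := fun _ _ hxy =>
  funext fun i => dependsOn_entryCLM i.2 hxy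

/-- If the total derivative of `G` involves only the first `k + 1` entries and `G` does not
involve the last entry, then `G` involves only the first `k`. -/
theorem DependsOn.of_totalDeriv {G : (Fin m → W) → F} (hG : Differentiable ℝ G) {k d : ℕ}
    (hm : k + d < m) (hD : DependsOn (totalDeriv G) {i | (i : ℕ) < k + 1})
    (hdep : DependsOn G {i | (i : ℕ) < k + d}) : DependsOn G {i | (i : ℕ) < k} := by
  induction d with
  | zero => exact hdep
  | succ d ih =>
    refine ih (by omega) fun x y hxy => ?_
    let p : Fin m := ⟨k + d, by omega⟩
    let q : Fin m := ⟨k + d + 1, by omega⟩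
    have hzero : ∀ ξ v, fderiv ℝ G ξ (Pi.single p v) = 0 := fun ξ v => by
      have hD' := hD (x := ξ + Pi.single q v) (y := ξ) fun i hi => by
        have : i ≠ q := fun h => by
          have hi' : (i : ℕ) < k + 1 := hi
          simp [h, q] at hi'
        simp [this]
      have hshift : shiftCLM W m m (Pi.single q v) = Pi.single p v := by
        ext1 i
        rw [shiftCLM_apply, Pi.single_apply]
        rcases lt_or_ge ((i : ℕ) + 1) m with him | him
        · rw [entryCLM_of_lt him, Pi.single_apply]
          simp [p, q, Fin.ext_iff]
        · rw [entryCLM_of_le him, if_neg]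
          intro h
          simp [h, p] at him
          omega
      rw [totalDeriv, totalDeriv, fderiv_eq_of_dependsOn hdep (y := ξ) fun i hi => by
        have : i ≠ q := fun h => by
          have hi' : (i : ℕ) < k + (d + 1) := hi
          simp [h, q] at hi'
          omega
        simp [this], map_add, map_add, hshift] at hD'
      simpa using hD'
    let w : Fin m → W := Pi.single p (y p - x p)
    have hline : ∀ t : ℝ, HasDerivAt (fun t : ℝ => G (x + t • w)) 0 t := fun t => by
      have h1 : HasDerivAt (fun t : ℝ => x + t • w) w t := by
        simpa using ((hasDerivAt_id t).smul_const w).const_add x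
      exact hzero (x + t • w) (y p - x p) ▸ (hG _).hasFDerivAt.comp_hasDerivAt t h1
    have hconst := is_const_of_deriv_eq_zero (fun t => (hline t).differentiableAt)
      (fun t => (hline t).deriv) 0 1
    simp only [zero_smul, add_zero, one_smul] at hconst
    rw [hconst]
    refine hdep fun i hi => ?_
    by_cases hip : i = p
    · subst hip
      simp [w]
    · have : (i : ℕ) < k + d := by
        have h1 : (i : ℕ) < k + (d + 1) := hi
        have h2 : (i : ℕ) ≠ k + d := fun h => hip (Fin.ext h)
        omega
      simp [w, hip, hxy i this]

end TotalDeriv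

section Homotopy

variable {W : Type*} [NormedAddCommGroup W] [NormedSpace ℝ W]

open Filter Topology in
/-- If the Euler–Lagrange expression vanishes along smooth periodic curves, then it vanishes as a
function of jets. -/
theorem sum_iterate_totalDeriv_eq_zero [CompleteSpace W] {k m : ℕ} (hm : 0 < m)
    {h : (Fin (k + 1) → W) → ℝ} (hh : ContDiff ℝ ∞ h) (v : W)
    (hE : ∀ u : ℝ → W, ContDiff ℝ ∞ u → Function.Periodic u 1 → ∀ x,
      ∑ j : Fin (k + 1), (-1 : ℝ) ^ (j : ℕ) *
        iteratedDeriv j (fun y => fderiv ℝ h (jet (k + 1) u y) (Pi.single j v)) x = 0)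
    (ξ : Fin m → W) :
    ∑ j : Fin (k + 1), (-1 : ℝ) ^ (j : ℕ) *
      totalDeriv^[j] (fun ζ => fderiv ℝ h (resizeCLM W m (k + 1) ζ) (Pi.single j v)) ξ = 0 := by
  obtain ⟨γ, rfl, hγ, hd⟩ := exists_contDiff_hasDerivAt_shift m ξ
  obtain ⟨φ, hφ, hper, hid⟩ := exists_contDiff_periodic_eventuallyEq_id
  let u : ℝ → W := fun y => γ (φ y) ⟨0, hm⟩
  have hu : ContDiff ℝ ∞ u := contDiff_pi.1 (hγ.comp hφ) _
  have huγ : u =ᶠ[𝓝 0] fun y => γ y ⟨0, hm⟩ := hid.mono fun y hy => by simp [u, hy]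
  have hjet : jet (k + 1) u =ᶠ[𝓝 0] fun y => resizeCLM W m (k + 1) (γ y) := by
    filter_upwards [eventually_all.2 fun i : Fin (k + 1) => huγ.iteratedDeriv i] with y hy
    rw [← jet_eq_of_hasDerivAt_shift hd hm]
    exact funext hy
  refine Eq.trans ?_ (hE u hu (fun y => by simp [u, hper y]) 0)
  refine Finset.sum_congr rfl fun j _ => ?_
  have hcongr : (fun y => fderiv ℝ h (jet (k + 1) u y) (Pi.single j v)) =ᶠ[𝓝 0]
      fun y => fderiv ℝ h (resizeCLM W m (k + 1) (γ y)) (Pi.single j v) :=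
    hjet.mono fun y hy => by simp only [hy]
  have hsmooth : ContDiff ℝ ∞ fun ζ => fderiv ℝ h (resizeCLM W m (k + 1) ζ) (Pi.single j v) :=
    ((hh.fderiv_right (m := ∞) (by simp)).comp (resizeCLM W m (k + 1)).contDiff).clm_apply
      contDiff_const
  rw [hcongr.iteratedDeriv_eq, iteratedDeriv_comp_of_hasDerivAt_shift hsmooth hd]

/-- The partial derivative of `h` with respect to the entry `j`, on jets with `m` entries. -/
noncomputable def jetPartial {k : ℕ} (m : ℕ) (h : (Fin (k + 1) → W) → ℝ) (j : Fin (k + 1))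
    (ξ : Fin m → W) : W →L[ℝ] ℝ :=
  (fderiv ℝ h (resizeCLM W m (k + 1) ξ)).comp (ContinuousLinearMap.single ℝ (fun _ => W) j)

theorem contDiff_jetPartial {k : ℕ} (m : ℕ) {h : (Fin (k + 1) → W) → ℝ} (hh : ContDiff ℝ ∞ h)
    (j : Fin (k + 1)) : ContDiff ℝ ∞ (jetPartial m h j) :=
  ((hh.fderiv_right (m := ∞) (by simp)).comp (resizeCLM W m (k + 1)).contDiff).clm_comp
    contDiff_const

theorem fderiv_resizeCLM_eq_sum_jetPartial {k m : ℕ} (h : (Fin (k + 1) → W) → ℝ)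
    (ξ η : Fin m → W) :
    fderiv ℝ h (resizeCLM W m (k + 1) ξ) (resizeCLM W m (k + 1) η) =
      ∑ j, jetPartial m h j ξ (entryCLM W m j η) := by
  conv_lhs => rw [← Finset.univ_sum_single (resizeCLM W m (k + 1) η), map_sum]
  rfl

theorem dependsOn_jetPartial {k : ℕ} (m : ℕ) (h : (Fin (k + 1) → W) → ℝ) (j : Fin (k + 1)) :
    DependsOn (jetPartial m h j) {i | (i : ℕ) < k + 1} := fun x y hxy => by
  rw [jetPartial, jetPartial, dependsOn_resizeCLM (k + 1) hxy]

/-- The boundary term produced by moving all derivatives off the variation `ξ`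
in `∑ j, ∂h/∂ξ_j (ζ) ξ_j`. -/
noncomputable def boundaryTerm {k : ℕ} (m : ℕ) (h : (Fin (k + 1) → W) → ℝ)
    (ζ ξ : Fin m → W) : ℝ :=
  ∑ j : Fin (k + 1), ∑ i ∈ Finset.range j,
    (-1) ^ i * totalDeriv^[i] (jetPartial m h j) ζ (entryCLM W m (j - (i + 1)) ξ)

theorem contDiff_boundaryTerm {k m : ℕ} {h : (Fin (k + 1) → W) → ℝ} (hh : ContDiff ℝ ∞ h) :
    ContDiff ℝ ∞ fun p : (Fin m → W) × ℝ => boundaryTerm m h (p.2 • p.1) p.1 := by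
  refine ContDiff.sum fun j _ => ContDiff.sum fun i _ => contDiff_const.mul ?_
  exact ((contDiff_iterate_totalDeriv (contDiff_jetPartial m hh j) i).comp
    (contDiff_snd.smul contDiff_fst)).clm_apply ((entryCLM W m _).contDiff.comp contDiff_fst)

theorem hasFDerivAt_apply_smul_entryCLM {m : ℕ} {q : (Fin m → W) → W →L[ℝ] ℝ}
    (hq : Differentiable ℝ q) (s : ℝ) (l : ℕ) (ξ : Fin m → W) :
    ∃ L : (Fin m → W) →L[ℝ] ℝ, HasFDerivAt (fun ζ => q (s • ζ) (entryCLM W m l ζ)) L ξ ∧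
      L (shiftCLM W m m ξ) = totalDeriv q (s • ξ) (entryCLM W m l ξ) +
        q (s • ξ) (entryCLM W m (l + 1) ξ) := by
  have h1 : HasFDerivAt (fun ζ : Fin m → W => s • ζ) (s • ContinuousLinearMap.id ℝ (Fin m → W)) ξ :=
    (hasFDerivAt_id ξ).const_smul s
  refine ⟨_, ((hq (s • ξ)).hasFDerivAt.comp ξ h1).clm_apply (entryCLM W m l).hasFDerivAt, ?_⟩
  simp [totalDeriv, entryCLM_shiftCLM, add_comm]

theorem fderiv_boundaryTerm {k m : ℕ} {h : (Fin (k + 1) → W) → ℝ} (hh : ContDiff ℝ ∞ h)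
    (hE : ∀ ξ : Fin m → W, ∑ j : Fin (k + 1),
      (-1 : ℝ) ^ (j : ℕ) • totalDeriv^[j] (jetPartial m h j) ξ = 0) (s : ℝ) (ξ : Fin m → W) :
    fderiv ℝ (fun ζ => boundaryTerm m h (s • ζ) ζ) ξ (shiftCLM W m m ξ) =
      fderiv ℝ h (s • resizeCLM W m (k + 1) ξ) (resizeCLM W m (k + 1) ξ) := by
  have hq : ∀ (j : Fin (k + 1)) (i : ℕ), Differentiable ℝ (totalDeriv^[i] (jetPartial m h j)) :=
    fun j i => (contDiff_iterate_totalDeriv (contDiff_jetPartial m hh j) i).differentiable (by simp)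
  choose L hL hLS using fun (j : Fin (k + 1)) (i : ℕ) =>
    hasFDerivAt_apply_smul_entryCLM (hq j i) s (j - (i + 1)) ξ
  have hd : HasFDerivAt (fun ζ => boundaryTerm m h (s • ζ) ζ)
      (∑ j : Fin (k + 1), ∑ i ∈ Finset.range j, (-1 : ℝ) ^ i • L j i) ξ :=
    HasFDerivAt.fun_sum fun j _ => HasFDerivAt.fun_sum fun i _ => (hL j i).const_mul _
  let T : Fin (k + 1) → ℕ → ℝ := fun j i =>
    (-1) ^ i * totalDeriv^[i] (jetPartial m h j) (s • ξ) (entryCLM W m (j - i) ξ)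
  have hinner : ∀ j : Fin (k + 1),
      ∑ i ∈ Finset.range j, (-1 : ℝ) ^ i * L j i (shiftCLM W m m ξ) = T j 0 - T j j := fun j => by
    rw [← Finset.sum_range_sub']
    refine Finset.sum_congr rfl fun i hi => ?_
    have hij : (j : ℕ) - (i + 1) + 1 = j - i := by
      have := Finset.mem_range.1 hi
      omega
    rw [hLS, hij]
    simp only [T, Function.iterate_succ_apply', pow_succ]
    ring
  have hend : ∑ j : Fin (k + 1), T j j = 0 := by
    have := congrArg (fun A : W →L[ℝ] ℝ => A (entryCLM W m 0 ξ)) (hE (s • ξ))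
    simpa [T] using this
  rw [hd.fderiv]
  simp only [sum_apply, smul_apply, smul_eq_mul]
  rw [Finset.sum_congr rfl fun j _ => hinner j, Finset.sum_sub_distrib, hend, sub_zero, ← map_smul,
    fderiv_resizeCLM_eq_sum_jetPartial]
  simp [T]

theorem dependsOn_boundaryTerm {k m : ℕ} {h : (Fin (k + 1) → W) → ℝ} (hh : ContDiff ℝ ∞ h)
    (s : ℝ) : DependsOn (fun ζ => boundaryTerm m h (s • ζ) ζ) {i | (i : ℕ) < k + k} := by
  intro x y hxy
  refine Finset.sum_congr rfl fun j _ => Finset.sum_congr rfl fun i hi => ?_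
  have hij := Finset.mem_range.1 hi
  rw [dependsOn_iterate_totalDeriv (contDiff_jetPartial m hh j) (dependsOn_jetPartial m h j) i
      (x := s • x) (y := s • y) fun l hl => by
        have hl' : (l : ℕ) < k + 1 + i := hl
        simp [hxy l (show (l : ℕ) < k + k by omega)],
    dependsOn_entryCLM (show (j : ℕ) - (i + 1) < k + k by omega) hxy]

/-- A density whose Euler–Lagrange expression vanishes as a function of jets is, up to a constant,
a total derivative. -/
theorem exists_isTotalDerivative [FiniteDimensional ℝ W] {k : ℕ} {h : (Fin (k + 1) → W) → ℝ}
    (hh : ContDiff ℝ ∞ h)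
    (hE : ∀ ξ : Fin (k + k + 1) → W, ∑ j : Fin (k + 1),
      (-1 : ℝ) ^ (j : ℕ) • totalDeriv^[j] (jetPartial (k + k + 1) h j) ξ = 0) :
    ∃ g : (Fin k → W) → ℝ, ContDiff ℝ ∞ g ∧ IsTotalDerivative h (h 0) g := by
  let m := k + k + 1
  let B : (Fin m → W) × ℝ → ℝ := fun p => boundaryTerm m h (p.2 • p.1) p.1
  have hB : ContDiff ℝ ∞ B := contDiff_boundaryTerm hh
  let G : (Fin m → W) → ℝ := fun ξ => ∫ s in (0 : ℝ)..1, B (ξ, s)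
  have hG : ContDiff ℝ ∞ G := contDiff_intervalIntegral_of_contDiff hB 0 1
  have hB1 : ContDiff ℝ 1 B := hB.of_le (by simp)
  have hDG : ∀ ξ, totalDeriv G ξ = h (resizeCLM W m (k + 1) ξ) - h 0 := fun ξ => by
    have hcont : Continuous fun s : ℝ =>
        (fderiv ℝ B (ξ, s)).comp (ContinuousLinearMap.inl ℝ (Fin m → W) ℝ) :=
      ((hB1.continuous_fderiv one_ne_zero).comp (by fun_prop)).clm_comp continuous_const
    have hpartial : ∀ s, (fderiv ℝ B (ξ, s)).comp (ContinuousLinearMap.inl ℝ (Fin m → W) ℝ) =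
        fderiv ℝ (fun ζ => B (ζ, s)) ξ := fun s =>
      ((hB1.differentiable one_ne_zero).hasFDerivAt_prodMk_left ξ s).fderiv.symm
    rw [totalDeriv, (hasFDerivAt_intervalIntegral_of_contDiff hB1 0 1 ξ).fderiv,
      ContinuousLinearMap.intervalIntegral_apply (hcont.intervalIntegrable _ _)]
    simp only [hpartial]
    have hderiv : ∀ s : ℝ, HasDerivAt (fun s : ℝ => h (s • resizeCLM W m (k + 1) ξ))
        (fderiv ℝ (fun ζ => B (ζ, s)) ξ (shiftCLM W m m ξ)) s := fun s => by
      rw [fderiv_boundaryTerm hh hE]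
      refine (hh.differentiable (by simp) _).hasFDerivAt.comp_hasDerivAt s ?_
      simpa using (hasDerivAt_id s).smul_const (resizeCLM W m (k + 1) ξ)
    rw [intervalIntegral.integral_eq_sub_of_hasDerivAt fun s _ => hderiv s]
    · simp
    · simp only [← hpartial]
      exact (hcont.clm_apply continuous_const).intervalIntegrable _ _
  have hGdep : DependsOn G {i | (i : ℕ) < k + k} := fun x y hxy =>
    intervalIntegral.integral_congr fun s _ => dependsOn_boundaryTerm hh s hxy
  have hGk : DependsOn G {i | (i : ℕ) < k} :=
    .of_totalDeriv (hG.differentiable (by simp)) (Nat.lt_succ_self _)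
      (fun x y hxy => by rw [hDG, hDG, dependsOn_resizeCLM (k + 1) hxy]) hGdep
  let g : (Fin k → W) → ℝ := fun η => G (resizeCLM W k m η)
  have hg : ContDiff ℝ ∞ g := hG.comp (resizeCLM W k m).contDiff
  have hGg : G = fun ξ => g (resizeCLM W m k ξ) := funext fun ξ => hGk fun i hi => by
    have hi' : (i : ℕ) < k := hi
    rw [resizeCLM_apply, entryCLM_of_lt hi', resizeCLM_apply, entryCLM_of_lt i.2]
  refine ⟨g, hg, fun ξ => ?_⟩
  have hkm : k + 1 ≤ m := by omega
  have hchain : totalDeriv G (resizeCLM W (k + 1) m ξ) =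
      fderiv ℝ g (resizeCLM W m k (resizeCLM W (k + 1) m ξ))
        (resizeCLM W m k (shiftCLM W m m (resizeCLM W (k + 1) m ξ))) := by
    rw [totalDeriv, hGg]
    exact congrArg (fun A => A (shiftCLM W m m (resizeCLM W (k + 1) m ξ)))
      ((hg.differentiable (by simp) _).hasFDerivAt.comp _ (resizeCLM W m k).hasFDerivAt).fderiv
  have hres : resizeCLM W m k (resizeCLM W (k + 1) m ξ) = resizeCLM W (k + 1) k ξ := by
    ext1 i
    rw [resizeCLM_apply, entryCLM_of_lt (by omega)]
    rfl
  have hshift : resizeCLM W m k (shiftCLM W m m (resizeCLM W (k + 1) m ξ)) =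
      shiftCLM W (k + 1) k ξ := by
    ext1 i
    rw [resizeCLM_apply, entryCLM_shiftCLM, entryCLM_of_lt (by omega)]
    rfl
  rw [hDG, resizeCLM_resizeCLM_self hkm, hres, hshift] at hchain
  linarith

end Homotopy

theorem vanishing_variational_derivative_iff_total_derivative
    (n k : ℕ) (hn : 1 ≤ n) (hk : 1 ≤ k)
    (h : (Fin (k + 1) → (Fin n → ℝ)) → ℝ) (hh : ContDiff ℝ (⊤ : ℕ∞) h) :
    (∀ u : ℝ → (Fin n → ℝ), ContDiff ℝ (⊤ : ℕ∞) u → Function.Periodic u 1 →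
      ∀ (α : Fin n) (x : ℝ),
        ∑ j : Fin (k + 1), (-1 : ℝ) ^ (j : ℕ) *
          iteratedDeriv (j : ℕ)
            (fun y => fderiv ℝ h (fun i : Fin (k + 1) => iteratedDeriv (i : ℕ) u y)
              (Pi.single j (Pi.single α 1))) x = 0)
    ↔ (∃ (c : ℝ) (g : (Fin k → (Fin n → ℝ)) → ℝ), ContDiff ℝ (⊤ : ℕ∞) g ∧
        ∀ u : ℝ → (Fin n → ℝ), ContDiff ℝ (⊤ : ℕ∞) u → ∀ x : ℝ,
          h (fun i : Fin (k + 1) => iteratedDeriv (i : ℕ) u x) =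
            c + deriv (fun y => g (fun j : Fin k => iteratedDeriv (j : ℕ) u y)) x) := by
  constructor
  · intro H
    obtain ⟨g, hg, hgh⟩ := exists_isTotalDerivative hh fun ξ => by
      refine ContinuousLinearMap.coe_injective ((Pi.basisFun ℝ (Fin n)).ext fun α => ?_)
      rw [Pi.basisFun_apply]
      refine Eq.trans ?_ (sum_iterate_totalDeriv_eq_zero (Nat.succ_pos (k + k)) hh
        (Pi.single α 1) (fun u hu hper x => H u hu hper α x) ξ)
      rw [ContinuousLinearMap.coe_coe]
      simp only [sum_apply, smul_apply, smul_eq_mul]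
      refine Finset.sum_congr rfl fun j _ => congrArg _ ?_
      exact (congrFun (iterate_totalDeriv_clm_comp (ContinuousLinearMap.apply ℝ ℝ (Pi.single α 1))
        (contDiff_jetPartial _ hh j) j) ξ).symm
    exact ⟨h 0, g, hg, (forall_jet_eq_iff_isTotalDerivative hg).2 hgh⟩
  · rintro ⟨c, g, hg, H⟩ u hu - α x
    exact eulerLagrange_eq_zero_of_isTotalDerivative hg
      ((forall_jet_eq_iff_isTotalDerivative hg).1 H) hu (Pi.single α 1) x
end
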